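/- Let n, d ≥ 2 be positive integers with gcd(n,d) = 1, and r an integer with d - n ≤ r ≤ dn - n, n ≡ -r (mod d), and let M = ((d-1)n - r)/d. Then modulo [n]Φ_n(q)^4: Σ_{k=0}^{M} [2dk+r] (q^r;q^d)_k^4/(q^d;q^d)_k^4 q^{(d-2r)k} ≡ q^{r(n+r-dn)/d} (q^{2r};q^d)_{((d-1)n-r)/d}/(q^d;q^d)_{((d-1)n-r)/d} · ([(d-1)n] - ([(d-1)n]^3 + [(d-1)n]^4(1-q)) Σ_{k=1}^{((d-1)n-r)/d} q^{kd}/[kd]^2) + [(d-1)n]^4 Σ_{k=1}^{((d-1)n-r)/d} q^{(kd-d-2dn+2n+2r)(d-dn+n)/d} (q^d;q^d)_{k-1}(q^{2r};q^d)_{k-1}/([dk-d+r]^3 (q^r;q^d)_{k-1}^2). -/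

import Mathlib

open Finset Polynomial

/-- The indeterminate `q`, as a rational function over `ℚ`. -/
noncomputable def q : RatFunc ℚ := RatFunc.X

/-- The q-shifted factorial `(q^r; q^d)_m = ∏_{j=0}^{m-1} (1 - q^{r+dj})`. -/
noncomputable def qPoch (r d : ℤ) (m : ℕ) : RatFunc ℚ :=
  ∏ j ∈ Finset.range m, (1 - q ^ (r + d * (j : ℤ)))

/-- The q-integer `[m] = (1-q^m)/(1-q)`. -/
noncomputable def qint (m : ℤ) : RatFunc ℚ := (1 - q ^ m) / (1 - q)

/-- Congruence of rational functions modulo a polynomial `P`: the difference can be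
written with numerator divisible by `P` and denominator coprime to `P`. -/
def modCong (A B : RatFunc ℚ) (P : Polynomial ℚ) : Prop :=
  ∃ c e : Polynomial ℚ, IsCoprime e P ∧
    A - B = algebraMap (Polynomial ℚ) (RatFunc ℚ) (P * c) /
            algebraMap (Polynomial ℚ) (RatFunc ℚ) e

/-- The q-integer `[n]` as a polynomial: `1 + q + ⋯ + q^{n-1}`. -/
noncomputable def qintPoly (n : ℕ) : Polynomial ℚ := ∑ i ∈ Finset.range n, Polynomial.X ^ i

section Hypergeometric

variable {K : Type*} [Field K]

/-- The shifted factorial `(a; p)_k` over a field. -/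
def shifted (p a : K) (k : ℕ) : K := ∏ j ∈ Finset.range k, (1 - a * p ^ j)

lemma shifted_zero (p a : K) : shifted p a 0 = 1 := by simp [shifted]

lemma shifted_succ (p a : K) (k : ℕ) :
    shifted p a (k + 1) = shifted p a k * (1 - a * p ^ k) := by
  simp [shifted, Finset.prod_range_succ]

lemma shifted_succ' (p a : K) (k : ℕ) :
    shifted p a (k + 1) = (1 - a) * shifted p (a * p) k := by
  simp only [shifted, Finset.prod_range_succ', pow_zero, mul_one]
  rw [mul_comm]
  congr 1
  exact Finset.prod_congr rfl fun j _ => by ring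

lemma shifted_mul_shift (p a : K) (k : ℕ) :
    (1 - a) * shifted p (a * p) k = shifted p a k * (1 - a * p ^ k) := by
  rw [← shifted_succ', shifted_succ]

lemma shifted_ne_zero {p a : K} {k : ℕ} (h : ∀ j < k, 1 - a * p ^ j ≠ 0) :
    shifted p a k ≠ 0 :=
  Finset.prod_ne_zero_iff.2 fun j hj => h j (Finset.mem_range.1 hj)

lemma shifted_pow_inv_eq_zero {p : K} (hp : p ≠ 0) (m : ℕ) :
    shifted p (p ^ m)⁻¹ (m + 1) = 0 := by
  rw [shifted_succ, inv_mul_cancel₀ (pow_ne_zero _ hp), sub_self, mul_zero]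

lemma saalschuetz_partial {p α β γ e z : K} (he : γ * e = α * β) (hp0 : p ≠ 0) (hz0 : z ≠ 0)
    (hβ : β ≠ 0) (hγ0 : γ ≠ 0) (he0 : e ≠ 0)
    (k : ℕ) (hp : ∀ j < k, 1 - p * p ^ j ≠ 0) (hγ : ∀ j < k, 1 - γ * p ^ j ≠ 0)
    (hez : 1 - e / z ≠ 0) (hez' : ∀ j < k, 1 - e * p / z * p ^ j ≠ 0)
    (hγz : 1 - γ * z ≠ 0) :
    ∑ i ∈ range (k + 1),
      (shifted p α i * shifted p β i * shifted p (p * z)⁻¹ i * p ^ i /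
        (shifted p p i * shifted p γ i * shifted p (e / z) i) -
      (1 - γ / α * z) * (1 - γ / β * z) / ((1 - γ * z) * (1 - z / e)) *
        (shifted p α i * shifted p β i * shifted p z⁻¹ i * p ^ i /
          (shifted p p i * shifted p γ i * shifted p (e * p / z) i))) =
      shifted p α (k + 1) * shifted p β (k + 1) * shifted p z⁻¹ k /
        (shifted p p k * shifted p γ k * shifted p (e * p / z) k) /
        ((1 - e / z) * (1 - γ * z)) := by
  have hez1 : z - e ≠ 0 := fun h => hez (by rw [sub_eq_zero] at h ⊢; rw [h, div_self he0])
  have hez2 : e - z ≠ 0 := fun h => hez1 (by rw [← neg_sub, h, neg_zero])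
  have hαe : α = γ * e / β := by rw [he, mul_div_assoc, div_self hβ, mul_one]
  induction k with
  | zero =>
    simp only [shifted_zero, shifted_succ, zero_add, range_one, sum_singleton, pow_zero, mul_one,
      div_one, one_mul]
    rw [hαe]
    field_simp
    ring
  | succ k ih =>
    rw [sum_range_succ, ih (fun j hj => hp j (by omega)) (fun j hj => hγ j (by omega))
      (fun j hj => hez' j (by omega))]
    have h1 := hp k (by omega)
    have h2 := hγ k (by omega)
    have h3 := hez' k (by omega)
    have n1 := shifted_ne_zero (fun j hj => hp j (by omega : j < k + 1))
    have n2 := shifted_ne_zero (fun j hj => hγ j (by omega : j < k + 1))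
    have n3 := shifted_ne_zero (fun j hj => hez' j (by omega : j < k + 1))
    rw [shifted_succ] at n1 n2 n3
    have n1' := left_ne_zero_of_mul n1
    have n2' := left_ne_zero_of_mul n2
    have n3' := left_ne_zero_of_mul n3
    have e1 : shifted p (p * z)⁻¹ (k + 1) = (1 - (p * z)⁻¹) * shifted p z⁻¹ k := by
      rw [shifted_succ']; congr 2; field_simp
    have e2 : shifted p (e / z) (k + 1) = (1 - e / z) * shifted p (e * p / z) k := by
      rw [shifted_succ']; congr 2; field_simp
    rw [e1, e2, shifted_succ p α (k + 1), shifted_succ p β (k + 1), shifted_succ p α k,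
      shifted_succ p β k, shifted_succ p z⁻¹ k, shifted_succ p p k, shifted_succ p γ k,
      shifted_succ p (e * p / z) k, pow_succ p k]
    generalize shifted p (e * p / z) k = E at *
    generalize shifted p α k = A at *
    generalize shifted p β k = B at *
    generalize shifted p γ k = C at *
    generalize shifted p p k = D at *
    generalize shifted p z⁻¹ k = F at *
    generalize p ^ k = x at *
    have h1' : 1 - x * p ≠ 0 := by rwa [mul_comm]
    have h3' : z - e * x * p ≠ 0 := by
      intro h; apply h3; field_simp; linear_combination h
    clear ih hp hγ hez' n1 n2 n3
    rw [hαe]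
    field_simp
    ring

end Hypergeometric


section Hypergeometric

variable {K : Type*} [Field K]

theorem saalschuetz {p α β γ e : K} (he : γ * e = α * β) (hp0 : p ≠ 0)
    (hβ : β ≠ 0) (hγ0 : γ ≠ 0) (he0 : e ≠ 0) (m : ℕ)
    (hp : ∀ j < m, 1 - p * p ^ j ≠ 0) (hγ : ∀ j < m, 1 - γ * p ^ j ≠ 0)
    (hep : ∀ j < m, e ≠ p ^ j) :
    ∑ i ∈ range (m + 1), shifted p α i * shifted p β i * shifted p (p ^ m)⁻¹ i * p ^ i /
        (shifted p p i * shifted p γ i * shifted p (e * p / p ^ m) i) =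
      shifted p (γ / α) m * shifted p (γ / β) m / (shifted p γ m * shifted p e⁻¹ m) := by
  induction m with
  | zero => simp [shifted_zero]
  | succ m ih =>
    have ih := ih (fun j hj => hp j (by omega)) (fun j hj => hγ j (by omega))
      (fun j hj => hep j (by omega))
    have hz0 : p ^ m ≠ 0 := pow_ne_zero _ hp0
    have hez : 1 - e / p ^ m ≠ 0 := by
      intro h
      apply hep m (by omega)
      field_simp at h
      linear_combination -h
    have hez' : ∀ j < m, 1 - e * p / p ^ m * p ^ j ≠ 0 := by
      intro j hj h
      apply hep (m - 1 - j) (by omega)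
      have : p ^ m = p ^ (m - 1 - j) * p * p ^ j := by
        rw [← pow_succ, ← pow_add]; congr 1; omega
      rw [this] at h
      have h1 : p ^ (m - 1 - j) ≠ 0 := pow_ne_zero _ hp0
      have h2 : p ^ j ≠ 0 := pow_ne_zero _ hp0
      field_simp at h
      linear_combination -h
    have key := saalschuetz_partial he hp0 hz0 hβ hγ0 he0 m
      (fun j hj => hp j (by omega)) (fun j hj => hγ j (by omega)) hez hez' (hγ m (by omega))
    rw [sum_sub_distrib, ← mul_sum, ih, sub_eq_iff_eq_add] at key
    have e0 : (p ^ (m + 1)) = p * p ^ m := by ring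
    have e1 : e * p / (p * p ^ m) = e / p ^ m := by field_simp
    rw [sum_range_succ, e0, e1, key]
    have e2 : shifted p (p * p ^ m)⁻¹ (m + 1) = (1 - (p * p ^ m)⁻¹) * shifted p (p ^ m)⁻¹ m := by
      rw [shifted_succ']; congr 2; field_simp
    have e3 : shifted p (e / p ^ m) (m + 1) = (1 - e / p ^ m) * shifted p (e * p / p ^ m) m := by
      rw [shifted_succ']; congr 2; field_simp
    have h1 := hp m (by omega)
    have h2 := hγ m (by omega)
    have n1 : shifted p p m ≠ 0 := shifted_ne_zero fun j hj => hp j (by omega)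
    have n2 : shifted p γ m ≠ 0 := shifted_ne_zero fun j hj => hγ j (by omega)
    have n3 : shifted p (e * p / p ^ m) m ≠ 0 := shifted_ne_zero hez'
    rw [e2, e3, shifted_succ p (γ / α), shifted_succ p (γ / β), shifted_succ p γ,
      shifted_succ p e⁻¹, shifted_succ p p]
    have e4 : shifted p α (m + 1) * shifted p β (m + 1) * shifted p (p ^ m)⁻¹ m /
        (shifted p p m * shifted p γ m * shifted p (e * p / p ^ m) m) /
        ((1 - e / p ^ m) * (1 - γ * p ^ m)) + shifted p α (m + 1) * shifted p β (m + 1) *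
        ((1 - (p * p ^ m)⁻¹) * shifted p (p ^ m)⁻¹ m) * (p * p ^ m) /
        (shifted p p m * (1 - p * p ^ m) * (shifted p γ m * (1 - γ * p ^ m)) *
        ((1 - e / p ^ m) * shifted p (e * p / p ^ m) m)) = 0 := by
      generalize shifted p (e * p / p ^ m) m = E at *
      generalize shifted p (p ^ m)⁻¹ m = F at *
      generalize p ^ m = z at *
      have h1' : 1 - z * p ≠ 0 := by rwa [mul_comm]
      have h2' : 1 - z * γ ≠ 0 := by rwa [mul_comm]
      have hez1 : z - e ≠ 0 := fun h => hez (by field_simp; rw [h, mul_zero])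
      field_simp
      ring
    rw [add_right_comm, e4, zero_add, inv_eq_one_div e, one_div_mul_eq_div,
      div_mul_div_comm]
    congr 1 <;> ring

/-- Reversal of the factors of a shifted factorial. -/
lemma shifted_reverse {p b : K} (hp0 : p ≠ 0) (hb : b ≠ 0) (m : ℕ) :
    shifted p (p / (b * p ^ m)) m * (b ^ m * p ^ (∑ j ∈ range m, j)) =
      (-1) ^ m * shifted p b m := by
  induction m with
  | zero => simp [shifted_zero]
  | succ m ih =>
    have hz0 : p ^ m ≠ 0 := pow_ne_zero _ hp0
    have e : p / (b * p ^ (m + 1)) * p = p / (b * p ^ m) := by rw [pow_succ]; field_simp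
    rw [shifted_succ', e, shifted_succ, sum_range_succ, pow_add, pow_succ b, pow_succ (-1 : K)]
    have : (1 - p / (b * p ^ (m + 1))) * (b * p ^ m) = -(1 - b * p ^ m) := by
      rw [pow_succ]; field_simp; ring
    linear_combination (1 - p / (b * p ^ (m + 1))) * b * p ^ m * ih +
      (-1) ^ m * shifted p b m * this

/-- The factor in front of the balanced series in the truncated Watson transformation. -/
def watsonFactor (p a : K) (m : ℕ) : K :=
  (1 - a) * shifted p (a * p) m ^ 2 / (shifted p p m ^ 2 * a ^ m)

/-- The summand of the balanced series in the truncated Watson transformation, without the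
factors depending on the free parameter. -/
def watsonTerm (p a : K) (m k : ℕ) : K :=
  shifted p (p / a) k * shifted p (a * p * p ^ m) k * shifted p (p ^ m)⁻¹ k *
    ((1 - a) / (1 - a * p ^ k)) * p ^ k / shifted p p k

lemma watson_diff {p a : K} (hp0 : p ≠ 0) (ha : a ≠ 0) (m k : ℕ)
    (hp : ∀ j < m + 1, 1 - p * p ^ j ≠ 0) (h3 : 1 - a * p ^ k ≠ 0)
    (h4 : 1 - a * p ^ (m + 1) ≠ 0) :
    watsonFactor p a (m + 1) * watsonTerm p a (m + 1) k -
        watsonFactor p a m * watsonTerm p a m k =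
      watsonFactor p a m * ((1 - a * (p ^ (m + 1)) ^ 2) * (1 - a) /
        (a * (1 - p ^ (m + 1)) ^ 2)) * (shifted p (p / a) k * shifted p (a * p ^ (m + 1)) k *
          shifted p (p ^ (m + 1))⁻¹ k * p ^ k / shifted p p k) := by
  unfold watsonFactor watsonTerm
  have hz0 : p ^ m ≠ 0 := pow_ne_zero _ hp0
  have h1 : 1 - p * p ^ m ≠ 0 := hp m (by omega)
  have h1' : 1 - (p * p ^ m)⁻¹ ≠ 0 := by
    intro h; apply h1; field_simp at h; linear_combination -h
  have h1'' : p * p ^ m - 1 ≠ 0 := by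
    intro h; apply h1; linear_combination -h
  have e0 : (p ^ (m + 1)) = p * p ^ m := by ring
  have e1 : shifted p (p ^ m)⁻¹ k =
      shifted p (p * p ^ m)⁻¹ k * (1 - (p * p ^ m)⁻¹ * p ^ k) / (1 - (p * p ^ m)⁻¹) := by
    rw [eq_div_iff h1', ← shifted_mul_shift, mul_comm]
    congr 2; field_simp
  rw [e0] at h4
  have e2 : shifted p (a * p * (p * p ^ m)) k = shifted p (a * (p * p ^ m)) k *
      (1 - a * (p * p ^ m) * p ^ k) / (1 - a * (p * p ^ m)) := by
    rw [eq_div_iff h4, ← shifted_mul_shift, mul_comm]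
    congr 2; ring
  have e3 : a * p * p ^ m = a * (p * p ^ m) := by ring
  rw [shifted_succ p (a * p), shifted_succ p p, e0, e1, e2, e3, pow_succ a]
  have n1 : shifted p p m ≠ 0 := shifted_ne_zero fun j hj => hp j (by omega)
  by_cases n2 : shifted p p k = 0
  · simp [n2]
  generalize shifted p p k = P1 at *
  generalize shifted p p m = P2 at *
  generalize shifted p (a * p) m = P3 at *
  generalize shifted p (p / a) k = P4 at *
  generalize shifted p (p * p ^ m)⁻¹ k = P5 at *
  generalize shifted p (a * (p * p ^ m)) k = P6 at *
  have am : a ^ m ≠ 0 := pow_ne_zero _ ha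
  generalize a ^ m = A at *
  generalize p ^ k = x at *
  clear e1 e2 e3 e0 hp
  have hz' : p * p ^ m ≠ 0 := mul_ne_zero hp0 hz0
  generalize p * p ^ m = Z at *
  field_simp
  ring

theorem truncated_watson {p a u : K} (hp0 : p ≠ 0) (ha : a ≠ 0) (hu : u ≠ 0) (m : ℕ)
    (hp : ∀ j < m, 1 - p * p ^ j ≠ 0) (h1 : ∀ j < m, 1 - p * u * p ^ j ≠ 0)
    (h2 : ∀ j < m, 1 - p / u * p ^ j ≠ 0) (h3 : ∀ k < m + 1, 1 - a * p ^ k ≠ 0) :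
    ∑ k ∈ range (m + 1), (1 - a * (p ^ k) ^ 2) *
        (shifted p a k ^ 2 * shifted p (a * u) k * shifted p (a / u) k /
          (shifted p p k ^ 2 * shifted p (p * u) k * shifted p (p / u) k)) * (p / a ^ 2) ^ k =
      watsonFactor p a m * ∑ k ∈ range (m + 1),
        watsonTerm p a m k / (shifted p (p * u) k * shifted p (p / u) k) := by
  induction m with
  | zero =>
    have := h3 0 (by omega)
    simp only [pow_zero, mul_one] at this
    simp [watsonFactor, watsonTerm, shifted_zero, div_self this]
  | succ m ih =>
    rw [sum_range_succ, ih (fun j hj => hp j (by omega)) (fun j hj => h1 j (by omega))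
      (fun j hj => h2 j (by omega)) (fun j hj => h3 j (by omega))]
    have hz0 : p ^ m ≠ 0 := pow_ne_zero _ hp0
    have hz0' : p ^ (m + 1) ≠ 0 := pow_ne_zero _ hp0
    have ext : ∑ k ∈ range (m + 1),
        watsonTerm p a m k / (shifted p (p * u) k * shifted p (p / u) k) =
        ∑ k ∈ range (m + 1 + 1),
        watsonTerm p a m k / (shifted p (p * u) k * shifted p (p / u) k) := by
      rw [sum_range_succ _ (m + 1)]
      simp [watsonTerm, shifted_pow_inv_eq_zero hp0]
    rw [ext, add_comm, ← eq_sub_iff_add_eq, mul_sum, mul_sum, ← sum_sub_distrib]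
    have hs := saalschuetz (p := p) (α := p / a) (β := a * p ^ (m + 1)) (γ := p * u)
      (e := p ^ (m + 1) / u) (by field_simp) hp0 (by positivity) (by positivity) (by positivity)
      (m + 1) hp h1 (by
        intro j hj h
        apply h2 (m - j) (by omega)
        have : p ^ (m + 1) = p * p ^ (m - j) * p ^ j := by
          rw [mul_assoc, ← pow_add, ← pow_succ']; congr 1; omega
        rw [this] at h
        have : p ^ j ≠ 0 := pow_ne_zero _ hp0
        field_simp at h
        field_simp
        linear_combination -h)
    have e1 : p ^ (m + 1) / u * p / p ^ (m + 1) = p / u := by field_simp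
    have e2 : p * u / (p / a) = a * u := by field_simp
    have e3 : p * u / (a * p ^ (m + 1)) = p / (a / u * p ^ (m + 1)) := by field_simp
    have e4 : (p ^ (m + 1) / u)⁻¹ = p / (p / u * p ^ (m + 1)) := by field_simp
    rw [e1, e2, e3, e4] at hs
    have key : ∀ k ∈ range (m + 1 + 1),
        watsonFactor p a (m + 1) *
          (watsonTerm p a (m + 1) k / (shifted p (p * u) k * shifted p (p / u) k)) -
        watsonFactor p a m *
          (watsonTerm p a m k / (shifted p (p * u) k * shifted p (p / u) k)) =
        watsonFactor p a m * ((1 - a * (p ^ (m + 1)) ^ 2) * (1 - a) /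
        (a * (1 - p ^ (m + 1)) ^ 2)) *
        (shifted p (p / a) k * shifted p (a * p ^ (m + 1)) k * shifted p (p ^ (m + 1))⁻¹ k * p ^ k /
        (shifted p p k * shifted p (p * u) k * shifted p (p / u) k)) := by
      intro k hk
      have := watson_diff hp0 ha m k hp (h3 k (mem_range.1 hk)) (h3 (m + 1) (by omega))
      rw [← mul_div_assoc, ← mul_div_assoc, ← sub_div, this, mul_div_assoc, div_div, mul_assoc (shifted p p k)]
    rw [sum_congr rfl key, ← mul_sum, hs]
    have r1 := shifted_reverse hp0 (b := a / u) (by positivity) (m + 1)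
    have r2 := shifted_reverse hp0 (b := p / u) (by positivity) (m + 1)
    have n1 : shifted p p (m + 1) ≠ 0 := shifted_ne_zero hp
    have n2 : shifted p (p * u) (m + 1) ≠ 0 := shifted_ne_zero h1
    have n3 : shifted p (p / u) (m + 1) ≠ 0 := shifted_ne_zero h2
    have n4 : shifted p (p / (p / u * p ^ (m + 1))) (m + 1) ≠ 0 := by
      intro h
      rw [h, zero_mul] at r2
      exact mul_ne_zero (pow_ne_zero _ (by simp)) n3 r2.symm
    have n5 : 1 - p ^ (m + 1) ≠ 0 := by
      have := hp m (by omega)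
      rwa [← pow_succ'] at this
    have r3 : shifted p (p / (a / u * p ^ (m + 1))) (m + 1) /
        shifted p (p / (p / u * p ^ (m + 1))) (m + 1) =
        shifted p (a / u) (m + 1) / shifted p (p / u) (m + 1) * (p / a) ^ (m + 1) := by
      have t : (p / u) ^ (m + 1) = (p / a) ^ (m + 1) * (a / u) ^ (m + 1) := by
        rw [← mul_pow]; congr 1; field_simp
      have t1 : (p / a) ^ (m + 1) ≠ 0 := pow_ne_zero _ (div_ne_zero hp0 ha)
      have t2 : (a / u) ^ (m + 1) ≠ 0 := pow_ne_zero _ (div_ne_zero ha hu)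
      have t3 : p ^ (∑ j ∈ range (m + 1), j) ≠ 0 := pow_ne_zero _ hp0
      rw [t] at r2
      rw [div_mul_eq_mul_div (shifted p (a / u) (m + 1)), div_eq_div_iff n4 n3]
      apply mul_right_cancel₀ (mul_ne_zero t2 t3)
      linear_combination shifted p (p / u) (m + 1) * r1 - shifted p (a / u) (m + 1) * r2
    have r4 : watsonFactor p a m * ((1 - a * (p ^ (m + 1)) ^ 2) * (1 - a) /
        (a * (1 - p ^ (m + 1)) ^ 2)) = (1 - a * (p ^ (m + 1)) ^ 2) * shifted p a (m + 1) ^ 2 /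
        (shifted p p (m + 1) ^ 2 * a ^ (m + 1)) := by
      unfold watsonFactor
      rw [shifted_succ' p a, shifted_succ p p m, pow_succ a, ← pow_succ']
      rw [shifted_succ p p m] at n1
      have := left_ne_zero_of_mul n1
      field_simp
    rw [r4, mul_div_mul_comm (shifted p (a * u) (m + 1)), r3]
    have : (p / a ^ 2) ^ (m + 1) = (p / a) ^ (m + 1) / a ^ (m + 1) := by
      rw [← div_pow]; congr 1; field_simp
    rw [this]
    field_simp

end Hypergeometric


section Hypergeometric

variable {K : Type*} [Field K]

theorem watson_evaluation {p a : K} (hp0 : p ≠ 0) (ha : a ≠ 0) (m : ℕ)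
    (hp : ∀ j < m, 1 - p * p ^ j ≠ 0) (h3 : ∀ k < m + 1, 1 - a * p ^ k ≠ 0)
    (h4 : ∀ j < m, 1 - p * (a * p ^ m) * p ^ j ≠ 0) :
    watsonFactor p a m * ∑ k ∈ range (m + 1),
        watsonTerm p a m k / (shifted p (p * (a * p ^ m)) k * shifted p (p / (a * p ^ m)) k) =
      (1 - a * p ^ m) * shifted p (a ^ 2) m / (a ^ m * shifted p p m) := by
  have hs := saalschuetz (p := p) (α := p / a) (β := a) (γ := a * p) (e := a⁻¹)
    (by field_simp) hp0 ha (mul_ne_zero ha hp0) (inv_ne_zero ha) m hp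
    (fun j hj h => h3 (j + 1) (by omega) (by rw [pow_succ']; linear_combination h))
    (fun j hj h => h3 j (by omega) (by rw [← h, mul_inv_cancel₀ ha, sub_self]))
  have e1 : a * p / (p / a) = a ^ 2 := by field_simp
  have e2 : a * p / a = p := by field_simp
  have e3 : a⁻¹ * p / p ^ m = p / (a * p ^ m) := by field_simp
  rw [e1, e2, e3, inv_inv] at hs
  have h30 : 1 - a ≠ 0 := by simpa using h3 0 (by omega)
  have key : ∀ k ∈ range (m + 1),
      watsonTerm p a m k / (shifted p (p * (a * p ^ m)) k * shifted p (p / (a * p ^ m)) k) =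
      shifted p (p / a) k * shifted p a k * shifted p (p ^ m)⁻¹ k * p ^ k /
        (shifted p p k * shifted p (a * p) k * shifted p (p / (a * p ^ m)) k) := by
    intro k hk
    have hk := mem_range.1 hk
    have n1 : shifted p (p * (a * p ^ m)) k ≠ 0 := shifted_ne_zero fun j hj => h4 j (by omega)
    have n2 : shifted p (a * p) k ≠ 0 := shifted_ne_zero fun j hj h =>
      h3 (j + 1) (by omega) (by rw [pow_succ']; linear_combination h)
    have h3k := h3 k hk
    have n3 : (1 - a) / (1 - a * p ^ k) = shifted p a k / shifted p (a * p) k := by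
      rw [div_eq_div_iff h3k n2, shifted_mul_shift]
    have e : a * p * p ^ m = p * (a * p ^ m) := by ring
    rw [watsonTerm, n3, e]
    generalize shifted p (p * (a * p ^ m)) k = N at *
    field_simp
  rw [sum_congr rfl key, hs, watsonFactor]
  have n2 : shifted p (a * p) m ≠ 0 := shifted_ne_zero fun j hj h =>
    h3 (j + 1) (by omega) (by rw [pow_succ']; linear_combination h)
  have n1 : shifted p p m ≠ 0 := shifted_ne_zero hp
  have n3 : shifted p a m ≠ 0 := shifted_ne_zero fun j hj => h3 j (by omega)
  have n4 := shifted_mul_shift p a m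
  field_simp
  linear_combination shifted p (a ^ 2) m * n4

end Hypergeometric


section Apery

variable {K : Type*} [Field K]

/-- The sum `∑_{j=1}^k p^j / (1 - p^j)^2`. -/
def qHarm (p : K) (k : ℕ) : K := ∑ j ∈ range k, p ^ (j + 1) / (1 - p ^ (j + 1)) ^ 2

lemma qHarm_succ (p : K) (k : ℕ) :
    qHarm p (k + 1) = qHarm p k + p ^ (k + 1) / (1 - p ^ (k + 1)) ^ 2 := by
  simp [qHarm, sum_range_succ]

/-- The `q`-analogue of the Apery numbers summand `binom(m+k,k) * binom(m,k)`, up to a unit. -/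
def aperyBeta (p : K) (m k : ℕ) : K :=
  shifted p (p * p ^ m) k * shifted p (p ^ m)⁻¹ k / shifted p p k ^ 2

lemma aperyBeta_zero (p : K) (m : ℕ) : aperyBeta p m 0 = 1 := by
  simp [aperyBeta, shifted_zero]

variable {p : K}

lemma pow_inv_mul_pow_ne (hp0 : p ≠ 0) (hp : ∀ j, 1 - p ^ (j + 1) ≠ 0) {i m : ℕ} (h : i < m) :
    1 - (p ^ m)⁻¹ * p ^ i ≠ 0 := by
  have : p ^ m = p ^ i * p ^ (m - 1 - i + 1) := by rw [← pow_add]; congr 1; omega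
  have h1 := hp (m - 1 - i)
  have h2 : p ^ i ≠ 0 := pow_ne_zero _ hp0
  have h3 : p ^ (m - 1 - i + 1) ≠ 0 := pow_ne_zero _ hp0
  rw [this]
  intro h
  apply h1
  field_simp at h
  linear_combination -h

lemma shifted_self_ne_zero (hp : ∀ j, 1 - p ^ (j + 1) ≠ 0) (k : ℕ) : shifted p p k ≠ 0 :=
  shifted_ne_zero fun j _ => by rw [← pow_succ']; exact hp j

lemma aperyBeta_ne_zero (hp0 : p ≠ 0) (hp : ∀ j, 1 - p ^ (j + 1) ≠ 0) {m k : ℕ} (h : k ≤ m) :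
    aperyBeta p m k ≠ 0 := by
  refine div_ne_zero (mul_ne_zero (shifted_ne_zero fun j _ => ?_) (shifted_ne_zero fun j hj => ?_))
    (pow_ne_zero _ (shifted_self_ne_zero hp k))
  · have := hp (m + j)
    rwa [show p * p ^ m * p ^ j = p ^ (m + j + 1) by ring]
  · exact pow_inv_mul_pow_ne hp0 hp (by omega)

lemma aperyBeta_succ (p : K) (m k : ℕ) :
    aperyBeta p m (k + 1) = aperyBeta p m k *
      ((1 - p * p ^ m * p ^ k) * (1 - (p ^ m)⁻¹ * p ^ k) / (1 - p * p ^ k) ^ 2) := by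
  simp only [aperyBeta, shifted_succ, mul_pow, div_mul_div_comm]
  congr 1
  ring

lemma aperyBeta_succ_left (hp0 : p ≠ 0) (hp : ∀ j, 1 - p ^ (j + 1) ≠ 0) {m k : ℕ} (h : k ≤ m) :
    aperyBeta p (m + 1) k = aperyBeta p m k *
      ((1 - p ^ (m + 1) * p ^ k) * (1 - (p ^ (m + 1))⁻¹) /
        ((1 - p ^ (m + 1)) * (1 - (p ^ (m + 1))⁻¹ * p ^ k))) := by
  have h1 := shifted_mul_shift p (p ^ (m + 1)) k
  have h2 := shifted_mul_shift p (p ^ (m + 1))⁻¹ k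
  have e : (p ^ (m + 1))⁻¹ * p = (p ^ m)⁻¹ := by rw [pow_succ]; field_simp
  have h3 := hp m
  have h4 := pow_inv_mul_pow_ne hp0 hp (i := k) (m := m + 1) (by omega)
  rw [e] at h2
  rw [mul_comm _ p] at h1
  rw [← div_eq_iff h4] at h2
  rw [mul_comm, ← eq_div_iff h3] at h1
  rw [aperyBeta, aperyBeta, h1, ← h2, ← pow_succ' p m]
  have h5 := shifted_self_ne_zero hp k
  generalize (p ^ (m + 1))⁻¹ = w at *
  field_simp

lemma aperyBeta_diag (hp0 : p ≠ 0) (hp : ∀ j, 1 - p ^ (j + 1) ≠ 0) (m : ℕ) :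
    aperyBeta p (m + 1) (m + 1) = -(aperyBeta p m m *
      ((1 - (p ^ (m + 1)) ^ 2 / p) * (1 + p ^ (m + 1)) /
        (p ^ (m + 1) * (1 - p ^ (m + 1))))) := by
  rw [aperyBeta_succ, aperyBeta_succ_left hp0 hp le_rfl]
  have h3 := hp m
  have h4 : 1 - p ≠ 0 := by simpa using hp 0
  have h5 : p ^ m ≠ 0 := pow_ne_zero _ hp0
  rw [pow_succ] at *
  generalize p ^ m = z at *
  have h6 : p - 1 ≠ 0 := fun h => h4 (by linear_combination -h)
  have h7 : 1 - p * z ≠ 0 := by rwa [mul_comm]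
  field_simp
  ring

/-- The normalising factor in the recurrence for the harmonic Apery sum. -/
def aperyNorm (p : K) (m : ℕ) : K := -(p ^ m * aperyBeta p m m)⁻¹

lemma apery_step_fst {p z x B : K} (hp0 : p ≠ 0) (hz0 : z ≠ 0) (hx0 : x ≠ 0) (h1 : 1 - z ≠ 0)
    (h1' : z - 1 ≠ 0)
    (h2 : z - x ≠ 0) (h3 : z - p * x ≠ 0) (h4 : 1 - p * x ≠ 0) (h5 : p - z ^ 2 ≠ 0)
    (h6 : 1 + z ≠ 0) :
    -(z / p) * (1 - z) / ((1 - z ^ 2 / p) * (1 + z)) *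
        (B * ((1 - z * x) * (1 - z⁻¹) / ((1 - z) * (1 - z⁻¹ * x))) * x / (1 - z⁻¹ * x)) -
      B * x / (1 - p * x / z) =
    (B * ((1 - z * x) * (1 - p * x / z) / (1 - p * x) ^ 2)) * (p * x) * (1 - p * x) ^ 2 *
      ((2 * z + 1 - z ^ 2 * (z + 2) / (p * x)) / ((p - z ^ 2) * (1 + z) * (z - 1))) /
        (1 - p * x / z) ^ 2 -
    B * x * (1 - x) ^ 2 *
      ((2 * z + 1 - z ^ 2 * (z + 2) / x) / ((p - z ^ 2) * (1 + z) * (z - 1))) /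
        (1 - x / z) ^ 2 := by
  field_simp
  ring

lemma apery_step_snd {p z x B : K} (hp0 : p ≠ 0) (hz0 : z ≠ 0) (hx0 : x ≠ 0)
    (h1' : z - 1 ≠ 0)
    (h2 : z - x ≠ 0) (h3 : z - p * x ≠ 0) (h4 : 1 - p * x ≠ 0) (h5 : p - z ^ 2 ≠ 0)
    (h6 : 1 + z ≠ 0) :
    B * x * x *
      ((2 * z + 1 - z ^ 2 * (z + 2) / x) / ((p - z ^ 2) * (1 + z) * (z - 1))) /
        (1 - x / z) ^ 2 + z / (1 - z) ^ 2 *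
      (B * x / (1 - p * x / z)) =
    (B * ((1 - z * x) * (1 - p * x / z) / (1 - p * x) ^ 2)) * (p * x) * (1 - p * x) ^ 2 *
      ((-z * (z ^ 2 + 4 * z + 2) + z ^ 2 * (2 * z ^ 2 + 4 * z + 1) / (p * x)) / ((p - z ^ 2) * (1 + z) * (z - 1) ^ 3)) /
        (1 - p * x / z) ^ 2 -
    B * x * (1 - x) ^ 2 *
      ((-z * (z ^ 2 + 4 * z + 2) + z ^ 2 * (2 * z ^ 2 + 4 * z + 1) / x) / ((p - z ^ 2) * (1 + z) * (z - 1) ^ 3)) /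
        (1 - x / z) ^ 2 := by
  have h3' : z - x * p ≠ 0 := by rwa [mul_comm x p]
  have h4' : 1 - x * p ≠ 0 := by rwa [mul_comm x p]
  rw [show (1 - z) ^ 2 = (z - 1) ^ 2 by ring]
  field_simp
  ring

lemma apery_boundary {p z w N : K} (hp0 : p ≠ 0) (hw0 : w ≠ 0) (hz : z = w * p)
   (h1' : z - 1 ≠ 0) (h2 : p - 1 ≠ 0)
   (h5 : p - z ^ 2 ≠ 0)
    (h6 : 1 + z ≠ 0) :
    -(z / p) * (1 - z) / ((1 - z ^ 2 / p) * (1 + z)) *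
        (-1 * ((1 - z * w) * (1 - z⁻¹) / ((1 - z) * (1 - z⁻¹ * w))) / (1 - z⁻¹ * w)) * (z / (1 - z) ^ 2) +
     (-1 * (1 - w) ^ 2 *
      ((2 * z + 1 - z ^ 2 * (z + 2) / w) / ((p - z ^ 2) * (1 + z) * (z - 1))) /
        (1 - w / z) ^ 2 * (z / (1 - z) ^ 2) +
      -1 * w *
      ((2 * z + 1 - z ^ 2 * (z + 2) / w) / ((p - z ^ 2) * (1 + z) * (z - 1))) /
        (1 - w / z) ^ 2 +
     -1 * (1 - w) ^ 2 *
      ((-z * (z ^ 2 + 4 * z + 2) + z ^ 2 * (2 * z ^ 2 + 4 * z + 1) / w) / ((p - z ^ 2) * (1 + z) * (z - 1) ^ 3)) /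
        (1 - w / z) ^ 2) -
     N * ((2 * z + 1 - z ^ 2 * (z + 2)) / ((p - z ^ 2) * (1 + z) * (z - 1))) /
        (1 - 1 / z) ^ 2 =
    (-(1 + z) * z / (1 - z) ^ 2) * (-w * N) / (1 - z * w) - (-(1 + z) * z / (1 - z) ^ 2) / (1 - z) +
     z * (-z * (-(z / p) * (1 - z) / ((1 - z ^ 2 / p) * (1 + z)) * N)) / (1 - z) ^ 3 := by
  have h1 : 1 - z ≠ 0 := fun h => h1' (by linear_combination -h)
  have h7 : 1 - z⁻¹ * w = (p - 1) / p := by rw [hz]; field_simp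
  have h8 : 1 - w / z = (p - 1) / p := by rw [hz]; field_simp
  have h9 : 1 - z * w = (p - z ^ 2) / p := by rw [hz]; field_simp
  have h10 : 1 - z ^ 2 / p = (p - z ^ 2) / p := by field_simp
  have hz0 : z ≠ 0 := by rw [hz]; exact mul_ne_zero hw0 hp0
  have h11 : w = z / p := by rw [hz]; field_simp
  have h12 : (1 - z) ^ 3 = - (z - 1) ^ 3 := by ring
  rw [h7, h8, h9, h10, h12, show (1 - z) ^ 2 = (z - 1) ^ 2 by ring, ← neg_sub z 1,
    h11]
  clear h7 h8 h9 h10 h11 h12 hz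
  field_simp
  ring

lemma one_sub_sq_div_ne (hp0 : p ≠ 0) (hp : ∀ j, 1 - p ^ (j + 1) ≠ 0) (m : ℕ) :
    p - (p ^ (m + 1)) ^ 2 ≠ 0 ∧ 1 + p ^ (m + 1) ≠ 0 := by
  constructor
  · have h := mul_ne_zero hp0 (hp (2 * m))
    intro h'
    apply h
    rw [← h']
    ring
  · intro h
    apply hp (2 * m + 1)
    rw [show 2 * m + 1 + 1 = (m + 1) * 2 by ring, pow_mul]
    linear_combination (1 - p ^ (m + 1)) * h

lemma aperyNorm_succ (hp0 : p ≠ 0) (hp : ∀ j, 1 - p ^ (j + 1) ≠ 0) (m : ℕ) :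
    aperyNorm p (m + 1) = -(p ^ (m + 1) / p) * (1 - p ^ (m + 1)) /
      ((1 - (p ^ (m + 1)) ^ 2 / p) * (1 + p ^ (m + 1))) * aperyNorm p m := by
  obtain ⟨h1, h2⟩ := one_sub_sq_div_ne hp0 hp m
  have h3 := hp m
  have h4 := aperyBeta_ne_zero hp0 hp (le_refl m)
  have h5 : p ^ m ≠ 0 := pow_ne_zero _ hp0
  rw [aperyNorm, aperyNorm, aperyBeta_diag hp0 hp]
  have h6 : 1 - (p ^ (m + 1)) ^ 2 / p = (p - (p ^ (m + 1)) ^ 2) / p := by field_simp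
  rw [h6]
  have e : p ^ (m + 1) = p ^ m * p := pow_succ _ _
  generalize p ^ (m + 1) = z at *
  have hz0 : z ≠ 0 := by rw [e]; exact mul_ne_zero h5 hp0
  have h7 : p ^ m = z / p := by rw [e]; field_simp
  rw [h7]
  field_simp

lemma apery_left_diff (hp0 : p ≠ 0) (hp : ∀ j, 1 - p ^ (j + 1) ≠ 0) {m : ℕ} (i : ℕ) (hi : i ≤ m) :
    ∑ j ∈ range i, (p ^ (j + 1) / (aperyBeta p (m + 1) (j + 1) * (1 - p ^ (j + 1)) ^ 3) -
        p ^ (j + 1) / (aperyBeta p m (j + 1) * (1 - p ^ (j + 1)) ^ 3)) =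
      (-(1 + p ^ (m + 1)) * p ^ (m + 1) / (1 - p ^ (m + 1)) ^ 2) * (aperyBeta p m i)⁻¹ /
          (1 - p ^ (m + 1) * p ^ i) -
        (-(1 + p ^ (m + 1)) * p ^ (m + 1) / (1 - p ^ (m + 1)) ^ 2) / (1 - p ^ (m + 1)) := by
  induction i with
  | zero => simp [aperyBeta_zero]
  | succ i ih =>
    rw [sum_range_succ, ih (by omega), aperyBeta_succ_left hp0 hp hi]
    have hz0 : p ^ (m + 1) ≠ 0 := pow_ne_zero _ hp0
    have hx0 : p ^ i ≠ 0 := pow_ne_zero _ hp0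
    have hw0 : p ^ m ≠ 0 := pow_ne_zero _ hp0
    have h1 := hp m
    have h1' : p ^ (m + 1) - 1 ≠ 0 := fun h => h1 (by linear_combination -h)
    have h2 := hp i
    have h3 : 1 - p ^ (m + 1) * p ^ i ≠ 0 := by
      have := hp (m + i)
      rwa [show m + i + 1 = m + 1 + i by ring, pow_add] at this
    have h4 : 1 - p ^ (m + 1) * (p * p ^ i) ≠ 0 := by
      have := hp (m + i + 1)
      rwa [show m + i + 1 + 1 = m + 1 + (i + 1) by ring, pow_add, pow_succ' p i] at this
    have h5 := pow_inv_mul_pow_ne hp0 hp (i := i) (m := m) (by omega)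
    have hB := aperyBeta_ne_zero hp0 hp (show i ≤ m by omega)
    rw [aperyBeta_succ]
    have h6 : (p ^ m)⁻¹ * p ^ i = p * p ^ i / p ^ (m + 1) := by rw [pow_succ]; field_simp
    rw [h6] at h5 ⊢
    rw [← pow_succ' p m, ← pow_succ' p i]
    rw [pow_succ' p i] at *
    generalize p ^ (m + 1) = z at *
    generalize p ^ i = x at *
    generalize aperyBeta p m i = B at *
    have h5' : z - p * x ≠ 0 := fun h => h5 (by
      rw [sub_eq_zero] at h ⊢; rw [← h, div_self hz0])
    rw [show (1 - z) ^ 2 = (z - 1) ^ 2 by ring, ← neg_sub z 1]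
    have h2' : 1 - x * p ≠ 0 := by rwa [mul_comm x p]
    have h4' : 1 - z * x * p ≠ 0 := by rwa [mul_assoc, mul_comm x p]
    have h5'' : z - x * p ≠ 0 := by rwa [mul_comm x p]
    clear h6 h5 ih
    field_simp
    ring

/-- The telescoping antidifference for the harmonic Apery sum. -/
def aperyAnti (p : K) (m k : ℕ) : K :=
  aperyNorm p m * aperyBeta p m k * p ^ k * (1 - p ^ k) ^ 2 *
      ((2 * p ^ (m + 1) + 1 - (p ^ (m + 1)) ^ 2 * (p ^ (m + 1) + 2) / p ^ k) /
        ((p - (p ^ (m + 1)) ^ 2) * (1 + p ^ (m + 1)) * (p ^ (m + 1) - 1))) /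
      (1 - p ^ k / p ^ (m + 1)) ^ 2 * (qHarm p (m + 1) - qHarm p k) +
    aperyNorm p m * aperyBeta p m k * p ^ k * p ^ k *
      ((2 * p ^ (m + 1) + 1 - (p ^ (m + 1)) ^ 2 * (p ^ (m + 1) + 2) / p ^ k) /
        ((p - (p ^ (m + 1)) ^ 2) * (1 + p ^ (m + 1)) * (p ^ (m + 1) - 1))) /
      (1 - p ^ k / p ^ (m + 1)) ^ 2 +
    aperyNorm p m * aperyBeta p m k * p ^ k * (1 - p ^ k) ^ 2 *
      ((-p ^ (m + 1) * ((p ^ (m + 1)) ^ 2 + 4 * p ^ (m + 1) + 2) +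
          (p ^ (m + 1)) ^ 2 * (2 * (p ^ (m + 1)) ^ 2 + 4 * p ^ (m + 1) + 1) / p ^ k) /
        ((p - (p ^ (m + 1)) ^ 2) * (1 + p ^ (m + 1)) * (p ^ (m + 1) - 1) ^ 3)) /
      (1 - p ^ k / p ^ (m + 1)) ^ 2

lemma aperyAnti_succ_sub (hp0 : p ≠ 0) (hp : ∀ j, 1 - p ^ (j + 1) ≠ 0) {m k : ℕ} (hk : k < m) :
    aperyNorm p (m + 1) * (aperyBeta p (m + 1) k * p ^ k / (1 - (p ^ (m + 1))⁻¹ * p ^ k) *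
        (qHarm p (m + 1) - qHarm p k)) -
      aperyNorm p m * (aperyBeta p m k * p ^ k / (1 - (p ^ m)⁻¹ * p ^ k) *
        (qHarm p m - qHarm p k)) = aperyAnti p m (k + 1) - aperyAnti p m k := by
  obtain ⟨hD1, hD2⟩ := one_sub_sq_div_ne hp0 hp m
  have hz1 := hp m
  have hz1' : p ^ (m + 1) - 1 ≠ 0 := fun h => hz1 (by linear_combination -h)
  have hz0 : p ^ (m + 1) ≠ 0 := pow_ne_zero _ hp0
  have hzx : ∀ k < m + 1, p ^ (m + 1) - p ^ k ≠ 0 := fun k hk h =>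
    pow_inv_mul_pow_ne hp0 hp hk (by field_simp; rw [h, mul_zero])
  have hx0 : p ^ k ≠ 0 := pow_ne_zero _ hp0
  have hw0 : p ^ m ≠ 0 := pow_ne_zero _ hp0
  have h2 := hzx k (by omega)
  have h3 := hzx (k + 1) (by omega)
  have h4 := hp k
  have h6 : (p ^ m)⁻¹ * p ^ k = p * p ^ k / p ^ (m + 1) := by rw [pow_succ]; field_simp
  have hH : qHarm p m = qHarm p (m + 1) - p ^ (m + 1) / (1 - p ^ (m + 1)) ^ 2 := by
    rw [qHarm_succ]; ring
  rw [pow_succ' p k] at h3 h4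
  have k1 := apery_step_fst (B := aperyNorm p m * aperyBeta p m k) hp0 hz0 hx0 hz1 hz1' h2 h3 h4
    hD1 hD2
  have k2 := apery_step_snd (B := aperyNorm p m * aperyBeta p m k) hp0 hz0 hx0 hz1' h2 h3 h4
    hD1 hD2
  rw [aperyAnti, aperyAnti, hH, qHarm_succ p k, aperyNorm_succ hp0 hp,
    aperyBeta_succ_left hp0 hp hk.le, aperyBeta_succ, h6, ← pow_succ' p m, pow_succ' p k]
  generalize qHarm p (m + 1) = H at *
  generalize qHarm p k = Hk at *
  generalize p ^ (m + 1) = z at *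
  generalize p ^ k = x at *
  generalize aperyBeta p m k = B at *
  generalize aperyNorm p m = N at *
  have e : N * (B * ((1 - z * x) * (1 - p * x / z) / (1 - p * x) ^ 2)) * (p * x) *
      (1 - p * x) ^ 2 *
      ((2 * z + 1 - z ^ 2 * (z + 2) / (p * x)) / ((p - z ^ 2) * (1 + z) * (z - 1))) /
        (1 - p * x / z) ^ 2 * (p * x / (1 - p * x) ^ 2) =
      N * (B * ((1 - z * x) * (1 - p * x / z) / (1 - p * x) ^ 2)) * (p * x) * (p * x) *
      ((2 * z + 1 - z ^ 2 * (z + 2) / (p * x)) / ((p - z ^ 2) * (1 + z) * (z - 1))) /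
        (1 - p * x / z) ^ 2 := by
    have h4' : (1 - p * x) ^ 2 ≠ 0 := pow_ne_zero _ h4
    generalize (1 - p * x) ^ 2 = Y at *
    generalize 1 - p * x / z = W at *
    generalize ((p - z ^ 2) * (1 + z) * (z - 1)) = U at *
    generalize (2 * z + 1 - z ^ 2 * (z + 2) / (p * x)) = U' at *
    field_simp
  linear_combination (H - Hk) * k1 + k2 + e

lemma apery_right_diff (hp0 : p ≠ 0) (hp : ∀ j, 1 - p ^ (j + 1) ≠ 0) (m i : ℕ) (hi : i ≤ m) :
    ∑ k ∈ range i, (aperyNorm p (m + 1) * (aperyBeta p (m + 1) k * p ^ k /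
        (1 - (p ^ (m + 1))⁻¹ * p ^ k) * (qHarm p (m + 1) - qHarm p k)) -
      aperyNorm p m * (aperyBeta p m k * p ^ k / (1 - (p ^ m)⁻¹ * p ^ k) *
        (qHarm p m - qHarm p k))) = aperyAnti p m i - aperyAnti p m 0 := by
  rw [← sum_range_sub]
  exact sum_congr rfl fun k hk => aperyAnti_succ_sub hp0 hp
    (lt_of_lt_of_le (mem_range.1 hk) hi)

theorem apery_harmonic (hp0 : p ≠ 0) (hp : ∀ j, 1 - p ^ (j + 1) ≠ 0) (m : ℕ) :
    aperyNorm p m * ∑ k ∈ range m,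
        (aperyBeta p m k * p ^ k / (1 - (p ^ m)⁻¹ * p ^ k) * (qHarm p m - qHarm p k)) =
      ∑ j ∈ range m, p ^ (j + 1) / (aperyBeta p m (j + 1) * (1 - p ^ (j + 1)) ^ 3) := by
  induction m with
  | zero => simp
  | succ m ih =>
    have hR := apery_right_diff hp0 hp m m le_rfl
    have hL := apery_left_diff hp0 hp m (le_refl m)
    rw [sum_sub_distrib, ← mul_sum, ← mul_sum, ih, sub_eq_iff_eq_add] at hR
    rw [sum_sub_distrib, sub_eq_iff_eq_add] at hL
    rw [sum_range_succ, sum_range_succ, mul_add, hR, hL]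
    obtain ⟨hD1, hD2⟩ := one_sub_sq_div_ne hp0 hp m
    have hz1 := hp m
    have hz1' : p ^ (m + 1) - 1 ≠ 0 := fun h => hz1 (by linear_combination -h)
    have hw0 : p ^ m ≠ 0 := pow_ne_zero _ hp0
    have hp1 : p - 1 ≠ 0 := fun h => hp 0 (by rw [zero_add, pow_one]; linear_combination -h)
    have hB := aperyBeta_ne_zero hp0 hp (le_refl m)
    have key := apery_boundary (N := aperyNorm p m) hp0 hw0 (pow_succ p m) hz1' hp1 hD1 hD2
    have t1 : aperyNorm p m * aperyBeta p m m * p ^ m = -1 := by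
      rw [aperyNorm]; field_simp
    have t2 : (aperyBeta p m m)⁻¹ = -p ^ m * aperyNorm p m := by
      rw [aperyNorm]; field_simp
    have t3 : (aperyBeta p (m + 1) (m + 1))⁻¹ = -p ^ (m + 1) * aperyNorm p (m + 1) := by
      have := aperyBeta_ne_zero hp0 hp (le_refl (m + 1))
      have hz0 : p ^ (m + 1) ≠ 0 := pow_ne_zero _ hp0
      rw [aperyNorm]; field_simp
    have t4 : qHarm p (m + 1) - qHarm p m = p ^ (m + 1) / (1 - p ^ (m + 1)) ^ 2 := by
      rw [qHarm_succ]; ring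
    have t5 : aperyAnti p m 0 = aperyNorm p m * ((2 * p ^ (m + 1) + 1 -
        (p ^ (m + 1)) ^ 2 * (p ^ (m + 1) + 2)) /
        ((p - (p ^ (m + 1)) ^ 2) * (1 + p ^ (m + 1)) * (p ^ (m + 1) - 1))) /
        (1 - 1 / p ^ (m + 1)) ^ 2 := by
      simp [aperyAnti, aperyBeta_zero]
    rw [t2, div_mul_eq_div_div, div_eq_mul_inv _ (aperyBeta _ _ _), t3, t5, aperyAnti, t1, t4,
      aperyNorm_succ hp0 hp, aperyBeta_succ_left hp0 hp le_rfl]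
    have t6 : ∀ c f g h : K, c * aperyNorm p m * (aperyBeta p m m * f * p ^ m / g * h) =
        c * (-1 * f / g) * h := by
      intro c f g h; rw [← t1]; ring
    rw [t6]
    linear_combination key

end Apery


section Apery

variable {K : Type*} [Field K] {p : K}

lemma aperyBeta_reverse (hp0 : p ≠ 0) (hp : ∀ j, 1 - p ^ (j + 1) ≠ 0) {m : ℕ} (i j : ℕ)
    (h : i + j = m) :
    shifted p p i * shifted p ((p ^ m) ^ 2)⁻¹ i * aperyBeta p m j =
      p ^ i * aperyBeta p m m * shifted p (p ^ m)⁻¹ i ^ 2 := by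
  induction i generalizing j with
  | zero => rw [zero_add] at h; simp [shifted_zero, h]
  | succ i ih =>
    have ih := ih (j + 1) (by omega)
    rw [aperyBeta_succ] at ih
    have hz : p ^ m = p ^ i * (p * p ^ j) := by rw [← pow_succ', ← pow_add]; congr 1; omega
    have hy := hp j
    rw [pow_succ'] at hy
    have hx0 : p ^ i ≠ 0 := pow_ne_zero _ hp0
    have hy0 : p ^ j ≠ 0 := pow_ne_zero _ hp0
    rw [shifted_succ, shifted_succ, shifted_succ, pow_succ' p i, mul_pow]
    generalize shifted p (p ^ m)⁻¹ i = S at *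
    generalize shifted p ((p ^ m) ^ 2)⁻¹ i = S' at *
    generalize aperyBeta p m m = G at *
    generalize aperyBeta p m j = B at *
    generalize shifted p p i = P at *
    rw [hz] at ih ⊢
    generalize p ^ i = x at *
    generalize p ^ j = y at *
    have e : (1 - p * x) * (1 - ((x * (p * y)) ^ 2)⁻¹ * x) = p * (1 - (x * (p * y))⁻¹ * x) ^ 2 *
        ((1 - p * (x * (p * y)) * y) * (1 - (x * (p * y))⁻¹ * y) / (1 - p * y) ^ 2) := by
      have hy' : 1 - y * p ≠ 0 := by rwa [mul_comm]
      field_simp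
      ring
    linear_combination p * (1 - (x * (p * y))⁻¹ * x) ^ 2 * ih + P * S' * B * e

theorem apery_identity (hp0 : p ≠ 0) (hp : ∀ j, 1 - p ^ (j + 1) ≠ 0) (m : ℕ) :
    ∑ k ∈ range m, p ^ k * shifted p p k * shifted p ((p ^ m) ^ 2)⁻¹ k /
        ((p ^ m) ^ 2 * (1 - (p ^ m)⁻¹ * p ^ k) ^ 3 * shifted p (p ^ m)⁻¹ k ^ 2) =
      (p ^ m)⁻¹ * ∑ k ∈ range m,
        (aperyBeta p m k * p ^ k / (1 - (p ^ m)⁻¹ * p ^ k) * (qHarm p m - qHarm p k)) := by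
  have hz0 : p ^ m ≠ 0 := pow_ne_zero _ hp0
  have h := apery_harmonic hp0 hp m
  have hB := aperyBeta_ne_zero hp0 hp (le_refl m)
  have e : ∀ R, (p ^ m)⁻¹ * R = -aperyBeta p m m * (aperyNorm p m * R) := by
    intro R; rw [aperyNorm]; field_simp
  rw [e, h, mul_sum, ← sum_range_reflect]
  refine sum_congr rfl fun j hj => ?_
  have hj := mem_range.1 hj
  have hr := aperyBeta_reverse hp0 hp (m - 1 - j) (j + 1) (by omega : _ = m)
  have hBj := aperyBeta_ne_zero hp0 hp (show j + 1 ≤ m by omega)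
  have hn : shifted p (p ^ m)⁻¹ (m - 1 - j) ≠ 0 := shifted_ne_zero fun i hi =>
    pow_inv_mul_pow_ne hp0 hp (by omega)
  have hk := pow_inv_mul_pow_ne hp0 hp (show m - 1 - j < m by omega)
  have hx0 : p ^ (m - 1 - j) ≠ 0 := pow_ne_zero _ hp0
  have hz : p ^ m = p ^ (m - 1 - j) * p ^ (j + 1) := by rw [← pow_add]; congr 1; omega
  have hz' : p ^ (j + 1) = p ^ m / p ^ (m - 1 - j) := by rw [hz]; field_simp
  rw [mul_assoc (p ^ _), (eq_div_iff hBj).2 hr]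
  rw [hz'] at *
  generalize p ^ (m - 1 - j) = x at *
  generalize shifted p (p ^ m)⁻¹ (m - 1 - j) = F at *
  generalize aperyBeta p m m = G at *
  generalize aperyBeta p m (j + 1) = G' at *
  generalize p ^ m = z at *
  have h1 : x - z ≠ 0 := fun h => hk (by
    rw [sub_eq_zero] at h; rw [h, inv_mul_cancel₀ hz0, sub_self])
  have e1 : 1 - z⁻¹ * x = - (x - z) / z := by field_simp; ring
  have e2 : 1 - z / x = (x - z) / x := by field_simp
  rw [e1, e2]
  field_simp

end Apery


section Valuation

variable {K Γ : Type*} [Field K] [LinearOrderedCommGroupWithZero Γ] {v : Valuation K Γ}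

/-- Congruence of `v`-integral elements up to an element of valuation at most `t`. -/
def VCong (v : Valuation K Γ) (t : Γ) (x y : K) : Prop :=
  v x ≤ 1 ∧ v y ≤ 1 ∧ v (x - y) ≤ t

namespace VCong

variable {t : Γ} {x x' y y' : K}

lemma of_le_one (h : v x ≤ 1) : VCong v t x x := ⟨h, h, by simp⟩

lemma one : VCong v t 1 1 := of_le_one (by simp)

lemma sub (h : VCong v t x x') (h' : VCong v t y y') : VCong v t (x - y) (x' - y') := by
  refine ⟨v.map_sub_le h.1 h'.1, v.map_sub_le h.2.1 h'.2.1, ?_⟩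
  rw [sub_sub_sub_comm]
  exact v.map_sub_le h.2.2 h'.2.2

lemma mul (h : VCong v t x x') (h' : VCong v t y y') : VCong v t (x * y) (x' * y') := by
  refine ⟨?_, ?_, ?_⟩
  · rw [map_mul]; exact mul_le_one' h.1 h'.1
  · rw [map_mul]; exact mul_le_one' h.2.1 h'.2.1
  · rw [show x * y - x' * y' = (x - x') * y + x' * (y - y') by ring]
    refine v.map_add_le ?_ ?_
    · rw [map_mul]; exact mul_le_of_le_of_le_one h.2.2 h'.1
    · rw [map_mul]; exact mul_le_of_le_one_of_le h.2.1 h'.2.2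

lemma pow (h : VCong v t x x') (k : ℕ) : VCong v t (x ^ k) (x' ^ k) := by
  induction k with
  | zero => simpa using one
  | succ k ih => rw [pow_succ, pow_succ]; exact ih.mul h

lemma inv (h : VCong v t x x') (hx : v x = 1) (hx' : v x' = 1) : VCong v t x⁻¹ x'⁻¹ := by
  refine ⟨by simp [hx], by simp [hx'], ?_⟩
  have h1 : x ≠ 0 := fun h0 => by simp [h0] at hx
  have h2 : x' ≠ 0 := fun h0 => by simp [h0] at hx'
  rw [show x⁻¹ - x'⁻¹ = -(x - x') * (x⁻¹ * x'⁻¹) by field_simp; ring]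
  simpa [hx, hx', v.map_sub_swap x' x] using h.2.2

lemma div (h : VCong v t x x') (h' : VCong v t y y') (hy : v y = 1) (hy' : v y' = 1) :
    VCong v t (x / y) (x' / y') := by
  rw [div_eq_mul_inv, div_eq_mul_inv]
  exact h.mul (h'.inv hy hy')

lemma sum {ι : Type*} {s : Finset ι} {f g : ι → K} (h : ∀ i ∈ s, VCong v t (f i) (g i)) :
    VCong v t (∑ i ∈ s, f i) (∑ i ∈ s, g i) := by
  refine ⟨v.map_sum_le fun i hi => (h i hi).1, v.map_sum_le fun i hi => (h i hi).2.1, ?_⟩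
  rw [← sum_sub_distrib]
  exact v.map_sum_le fun i hi => (h i hi).2.2

lemma shifted {p : K} (hp : v p ≤ 1) (h : VCong v t x x') (k : ℕ) :
    VCong v t (shifted p x k) (shifted p x' k) := by
  induction k with
  | zero => simpa [shifted_zero] using one
  | succ k ih =>
    rw [shifted_succ, shifted_succ]
    exact ih.mul (one.sub (h.mul ((of_le_one hp).pow k)))

end VCong

lemma valuation_shifted_eq_one {p x : K} {k : ℕ} (h : ∀ j < k, v (1 - x * p ^ j) = 1) :
    v (shifted p x k) = 1 := by
  rw [shifted, map_prod]
  exact Finset.prod_eq_one fun j hj => h j (mem_range.1 hj)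

lemma valuation_shifted_le_one {p x : K} (hp : v p ≤ 1) (hx : v x ≤ 1) (k : ℕ) :
    v (shifted p x k) ≤ 1 :=
  ((VCong.of_le_one (t := 1) hx).shifted hp k).1

end Valuation


section Expansion

variable {K Γ : Type*} [Field K] [LinearOrderedCommGroupWithZero Γ] {v : Valuation K Γ}

lemma valuation_qHarm_le_one {p : K} (hp : v p = 1) {k : ℕ}
    (hpj : ∀ j < k, v (1 - p ^ (j + 1)) = 1) : v (qHarm p k) ≤ 1 :=
  v.map_sum_le fun j hj => by simp [hp, hpj j (mem_range.1 hj)]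

lemma valuation_one_sub_mul_pow {p x : K} (hp : v p = 1) {k m : ℕ} (hk : k < m)
    (hpj : ∀ j < m, v (1 - p ^ (j + 1)) = 1) (hx : v (1 - x * p ^ m) < 1) :
    v (1 - x * p ^ k) = 1 := by
  have hp0 : p ≠ 0 := fun h => by simp [h] at hp
  have h1 := hpj (m - 1 - k) (by omega)
  have e : p ^ m = p ^ k * p ^ (m - 1 - k + 1) := by rw [← pow_add]; congr 1; omega
  have h2 : v (p ^ (m - 1 - k + 1)) = 1 := by simp [hp]
  have h0 : p ^ (m - 1 - k + 1) ≠ 0 := pow_ne_zero _ hp0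
  rw [e] at hx
  generalize p ^ (m - 1 - k + 1) = w at *
  have : 1 - x * p ^ k = ((1 - x * (p ^ k * w)) - (1 - w)) / w := by field_simp; ring
  rw [this, map_div₀, h2, div_one, v.map_sub_eq_of_lt_right (by rwa [h1]), h1]

lemma watson_ratio_expansion {p y : K} (hp : v p = 1) (hy : v y = 1) (hε : v (1 - y) < 1)
    {k : ℕ} (hpj : ∀ j < k, v (1 - p ^ (j + 1)) = 1) :
    v (shifted p p k ^ 2 / (shifted p (p * y) k * shifted p (p / y) k) - 1 -
      (1 - y) ^ 2 / y * qHarm p k) ≤ v (1 - y) ^ 4 := by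
  induction k with
  | zero => simp [shifted_zero, qHarm]
  | succ k ih =>
    have ih := ih fun j hj => hpj j (by omega)
    have hH := valuation_qHarm_le_one hp (fun j hj => hpj j (by omega) : ∀ j < k, _)
    have hk := hpj k (by omega)
    have hy0 : y ≠ 0 := fun h => by simp [h] at hy
    have hv0 : v ((1 - y) ^ 2 / y) = v (1 - y) ^ 2 := by simp [hy]
    set w := (1 - y) ^ 2 / y with hw
    set h := p ^ (k + 1) / (1 - p ^ (k + 1)) ^ 2 with hh
    have hvh : v h = 1 := by simp [hh, hp, hk]
    have hvw : v w < 1 := by rw [hv0]; exact pow_lt_one₀ zero_le hε (by simp)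
    have hvhw : v (h * w) < 1 := by rwa [map_mul, hvh, one_mul]
    have h1 : v (1 - h * w) = 1 := v.map_one_sub_of_lt hvhw
    have h1' : 1 - h * w ≠ 0 := fun h0 => by simp [h0] at h1
    have hk0 : 1 - p ^ (k + 1) ≠ 0 := fun h0 => by simp [h0] at hk
    have e : shifted p p (k + 1) ^ 2 / (shifted p (p * y) (k + 1) * shifted p (p / y) (k + 1)) =
        shifted p p k ^ 2 / (shifted p (p * y) k * shifted p (p / y) k) *
          (1 + h * w + (h * w) ^ 2 / (1 - h * w)) := by
      have : (1 - p * y * p ^ k) * (1 - p / y * p ^ k) = (1 - p ^ (k + 1)) ^ 2 * (1 - h * w) := by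
        rw [hh, hw]; field_simp; ring
      rw [shifted_succ, shifted_succ, shifted_succ, mul_mul_mul_comm, this, ← pow_succ', mul_pow,
        mul_div_mul_comm]
      congr 1
      field_simp
      ring
    rw [e, qHarm_succ, ← hh]
    generalize shifted p p k ^ 2 / (shifted p (p * y) k * shifted p (p / y) k) = Ω at *
    set η := Ω - 1 - w * qHarm p k with hη
    have hΩ : Ω = 1 + w * qHarm p k + η := by rw [hη]; ring
    have hθ : v ((h * w) ^ 2 / (1 - h * w)) = v (1 - y) ^ 4 := by
      rw [map_div₀, h1, div_one, map_pow, map_mul, hvh, one_mul, hv0, ← pow_mul]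
    generalize (h * w) ^ 2 / (1 - h * w) = θ at *
    have : Ω * (1 + h * w + θ) - 1 - w * (qHarm p k + h) =
        w ^ 2 * (qHarm p k * h) + η * (1 + h * w + θ) + θ * (1 + w * qHarm p k) := by
      rw [hΩ]; ring
    rw [this]
    have b1 : v (1 + w * qHarm p k) ≤ 1 := v.map_add_le (by simp)
      (by rw [map_mul]; exact mul_le_one' hvw.le hH)
    have b2 : v (1 + h * w + θ) ≤ 1 := v.map_add_le (v.map_add_le (by simp) hvhw.le)
      (by rw [hθ]; exact pow_le_one' hε.le 4)
    refine v.map_add_le (v.map_add_le ?_ ?_) ?_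
    · rw [map_mul, map_mul, hvh, mul_one, map_pow, hv0, ← pow_mul]
      exact mul_le_of_le_one_right' hH
    · rw [map_mul]; exact mul_le_of_le_of_le_one ih b2
    · rw [map_mul, hθ]; exact mul_le_of_le_one_right' b1

/-- The double zero removed from `watsonFactor * watsonTerm / (p; p)_k ^ 2`. -/
def watsonReduced (p a : K) (m k : ℕ) : K :=
  (1 - a) ^ 2 * shifted p (a * p) m ^ 2 / (shifted p p (m + 1) ^ 2 * a ^ (m + 1)) *
    (shifted p (p / a) k * shifted p (a * p * p ^ (m + 1)) k * shifted p (p ^ (m + 1))⁻¹ k *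
      p ^ k / ((1 - a * p ^ k) * shifted p p k ^ 3))

lemma watsonReduced_eq (p a : K) (m k : ℕ) :
    watsonFactor p a (m + 1) * (watsonTerm p a (m + 1) k / shifted p p k ^ 2) =
      (1 - a * p ^ (m + 1)) ^ 2 * watsonReduced p a m k := by
  rw [watsonFactor, watsonTerm, watsonReduced, shifted_succ p (a * p), pow_succ' p m]
  simp only [div_eq_mul_inv, mul_inv]
  ring

lemma watsonReduced_inv {p : K} (hp0 : p ≠ 0) (hp : ∀ j, 1 - p ^ (j + 1) ≠ 0) (m k : ℕ) :
    watsonReduced p (p ^ (m + 1))⁻¹ m k = (p ^ (m + 1))⁻¹ *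
      (aperyBeta p (m + 1) k * p ^ k / (1 - (p ^ (m + 1))⁻¹ * p ^ k)) := by
  have hz0 : p ^ (m + 1) ≠ 0 := pow_ne_zero _ hp0
  have hr := shifted_reverse hp0 (inv_ne_zero hz0) (m + 1)
  rw [inv_mul_cancel₀ hz0, div_one] at hr
  have hs : (1 - (p ^ (m + 1))⁻¹) * shifted p ((p ^ (m + 1))⁻¹ * p) m =
    shifted p (p ^ (m + 1))⁻¹ (m + 1) := (shifted_succ' _ _ _).symm
  have hn := shifted_self_ne_zero hp (m + 1)
  have hk := shifted_self_ne_zero hp k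
  have hsq : shifted p (p ^ (m + 1))⁻¹ (m + 1) ^ 2 =
      (p ^ (m + 1))⁻¹ * (shifted p p (m + 1) ^ 2 * (p ^ (m + 1))⁻¹ ^ (m + 1)) := by
    have h1 : shifted p (p ^ (m + 1))⁻¹ (m + 1) ^ 2 =
        ((-1) ^ (m + 1) * shifted p (p ^ (m + 1))⁻¹ (m + 1)) ^ 2 := by
      rw [mul_pow, ← pow_mul, pow_mul', neg_one_sq, one_pow, one_mul]
    have h2 : (p ^ ∑ j ∈ range (m + 1), j) ^ 2 = (p ^ (m + 1)) ^ (m + 1) / p ^ (m + 1) := by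
      rw [eq_div_iff hz0, ← pow_mul, sum_range_id_mul_two, ← pow_mul, ← pow_add]
      congr 1
    rw [h1, ← hr, mul_pow, mul_pow, h2]
    field_simp
    rw [← mul_pow, one_div_mul_cancel hz0, one_pow]
  rw [watsonReduced, ← mul_pow, hs, hsq, mul_div_cancel_right₀ _
    (mul_ne_zero (pow_ne_zero 2 hn) (pow_ne_zero _ (inv_ne_zero hz0))), aperyBeta,
    div_inv_eq_mul, show (p ^ (m + 1))⁻¹ * p * p ^ (m + 1) = p by field_simp]
  field_simp

end Expansion


section Expansion

variable {K Γ : Type*} [Field K] [LinearOrderedCommGroupWithZero Γ] {v : Valuation K Γ}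

lemma watson_specialized {p a : K} (hp0 : p ≠ 0) (ha : a ≠ 0) (m : ℕ)
    (hp : ∀ j, 1 - p ^ (j + 1) ≠ 0) (h3 : ∀ k < m + 1, 1 - a * p ^ k ≠ 0) :
    ∑ k ∈ range (m + 1), (1 - a * (p ^ k) ^ 2) * (shifted p a k ^ 4 / shifted p p k ^ 4) *
        (p / a ^ 2) ^ k =
      ∑ k ∈ range (m + 1), watsonFactor p a m * (watsonTerm p a m k / shifted p p k ^ 2) := by
  have hp' : ∀ j < m, 1 - p * p ^ j ≠ 0 := fun j _ => by rw [← pow_succ']; exact hp j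
  have h := truncated_watson (u := 1) hp0 ha one_ne_zero m hp' (by simpa using hp')
    (by simpa using hp') h3
  simp only [mul_one, div_one] at h
  rw [← mul_sum]
  convert h using 4
  · congr 1 <;> ring
  · ring

/-- The second sum in the expansion of the truncated very-well-poised series. -/
def residualTerm (p a : K) (m k : ℕ) : K :=
  p ^ k * (a * p ^ m) ^ (2 * m - k) * shifted p p k * shifted p (a ^ 2) k /
    ((p ^ m) ^ 2 * (1 - a * p ^ k) ^ 3 * shifted p a k ^ 2)

lemma residual_cong {p a : K} (hvp : v p = 1) (hva : v a = 1)
    (hp : ∀ j, 1 - p ^ (j + 1) ≠ 0) (m : ℕ) (hpj : ∀ j < m + 1, v (1 - p ^ (j + 1)) = 1)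
    (hε : v (1 - a * p ^ (m + 1)) < 1) :
    v (∑ k ∈ range (m + 1), watsonReduced p a m k / (a * p ^ (m + 1)) *
        (qHarm p (m + 1) - qHarm p k) -
      ∑ k ∈ range (m + 1), residualTerm p a (m + 1) k) ≤ v (1 - a * p ^ (m + 1)) := by
  have hp0 : p ≠ 0 := fun h => by simp [h] at hvp
  have hz0 : p ^ (m + 1) ≠ 0 := pow_ne_zero _ hp0
  have hvz : v (p ^ (m + 1))⁻¹ = 1 := by simp [hvp]
  set t := v (1 - a * p ^ (m + 1)) with ht
  have hb : (p ^ (m + 1))⁻¹ * p ^ (m + 1) = 1 := inv_mul_cancel₀ hz0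
  have hva' : VCong v t a (p ^ (m + 1))⁻¹ := by
    refine ⟨hva.le, hvz.le, ?_⟩
    rw [ht, v.map_sub_swap, show (p ^ (m + 1))⁻¹ - a = (1 - a * p ^ (m + 1)) * (p ^ (m + 1))⁻¹ by
      field_simp, map_mul, hvz, mul_one]
  have cp : VCong v t p p := .of_le_one hvp.le
  have ua : ∀ k < m + 1, v (1 - a * p ^ k) = 1 := fun k hk =>
    valuation_one_sub_mul_pow hvp hk hpj hε
  have ub : ∀ k < m + 1, v (1 - (p ^ (m + 1))⁻¹ * p ^ k) = 1 := fun k hk =>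
    valuation_one_sub_mul_pow hvp hk hpj (by rw [hb]; simp)
  have up : ∀ k ≤ m + 1, v (shifted p p k) = 1 := fun k hk =>
    valuation_shifted_eq_one fun j hj => by rw [← pow_succ']; exact hpj j (by omega)
  have cH : ∀ k ≤ m + 1, v (qHarm p k) ≤ 1 := fun k hk =>
    valuation_qHarm_le_one hvp fun j hj => hpj j (by omega)
  have zero : ∑ k ∈ range (m + 1), watsonReduced p (p ^ (m + 1))⁻¹ m k /
      ((p ^ (m + 1))⁻¹ * p ^ (m + 1)) * (qHarm p (m + 1) - qHarm p k) -
      ∑ k ∈ range (m + 1), residualTerm p (p ^ (m + 1))⁻¹ (m + 1) k = 0 := by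
    rw [sub_eq_zero]
    have h := apery_identity hp0 hp (m + 1)
    rw [mul_sum] at h
    simp only [hb, watsonReduced_inv hp0 hp, div_one, residualTerm, one_pow, mul_one]
    rw [inv_pow, h]
    exact sum_congr rfl fun k _ => by ring
  have c1 : VCong v t 1 1 := .one
  suffices h : VCong v t (∑ k ∈ range (m + 1), watsonReduced p a m k / (a * p ^ (m + 1)) *
      (qHarm p (m + 1) - qHarm p k) - ∑ k ∈ range (m + 1), residualTerm p a (m + 1) k)
      (∑ k ∈ range (m + 1), watsonReduced p (p ^ (m + 1))⁻¹ m k /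
      ((p ^ (m + 1))⁻¹ * p ^ (m + 1)) * (qHarm p (m + 1) - qHarm p k) -
      ∑ k ∈ range (m + 1), residualTerm p (p ^ (m + 1))⁻¹ (m + 1) k) by
    have := h.2.2
    rwa [zero, sub_zero] at this
  refine .sub (.sum fun k hk => ?_) (.sum fun k hk => ?_)
  · have hk := mem_range.1 hk
    refine .mul (.div ?_ (hva'.mul (cp.pow _)) (by simp [hva, hvp]) (by simp [hvp]))
      (.of_le_one (v.map_sub_le (cH _ le_rfl) (cH _ hk.le)))
    refine .mul (.div (((c1.sub hva').pow 2).mul (((hva'.mul cp).shifted hvp.le m).pow 2))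
      (.mul ((cp.shifted hvp.le _).pow 2) (hva'.pow _)) ?_ ?_) (.div ?_ ?_ ?_ ?_)
    · simp [up, hva]
    · simp [up, hvp]
    · exact .mul (.mul (.mul ((cp.div hva' hva hvz).shifted hvp.le k)
        (((hva'.mul cp).mul (cp.pow _)).shifted hvp.le k)) ((VCong.of_le_one hvz.le).shifted hvp.le k))
        (cp.pow k)
    · exact .mul (c1.sub (hva'.mul (cp.pow k))) ((cp.shifted hvp.le k).pow 3)
    · rw [map_mul, map_pow, up k hk.le, ua k hk]; simp
    · rw [map_mul, map_pow, up k hk.le, ub k hk]; simp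
  · have hk := mem_range.1 hk
    have sa : ∀ b : K, (∀ k < m + 1, v (1 - b * p ^ k) = 1) →
        v ((p ^ (m + 1)) ^ 2 * (1 - b * p ^ k) ^ 3 * shifted p b k ^ 2) = 1 := by
      intro b hb'
      rw [map_mul, map_mul, map_pow, map_pow, map_pow, map_pow, hvp, hb' k hk,
        valuation_shifted_eq_one fun j hj => hb' j (by omega)]
      simp
    exact .div (.mul (.mul (.mul (cp.pow k) ((hva'.mul (cp.pow _)).pow _)) (cp.shifted hvp.le k))
      ((hva'.pow 2).shifted hvp.le k))
      (.mul (.mul ((cp.pow _).pow 2) ((c1.sub (hva'.mul (cp.pow k))).pow 3))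
        ((hva'.shifted hvp.le k).pow 2)) (sa _ ua) (sa _ ub)

/-- The truncated very-well-poised series. -/
def poisedSum (p a : K) (m : ℕ) : K :=
  ∑ k ∈ range (m + 1), (1 - a * (p ^ k) ^ 2) * (shifted p a k ^ 4 / shifted p p k ^ 4) *
    (p / a ^ 2) ^ k

/-- The expansion of `poisedSum p a m` to fifth order in `1 - a * p ^ m`. -/
def poisedExpansion (p a : K) (m : ℕ) : K :=
  (1 - a * p ^ m) * shifted p (a ^ 2) m / (a ^ m * shifted p p m) *
    (1 - ((1 - a * p ^ m) ^ 2 + (1 - a * p ^ m) ^ 3) * qHarm p m) +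
    (1 - a * p ^ m) ^ 4 * ∑ k ∈ range m, residualTerm p a m k

theorem poised_expansion {p a : K} (hvp : v p = 1) (hva : v a = 1)
    (hp : ∀ j, 1 - p ^ (j + 1) ≠ 0) (m : ℕ) (hpj : ∀ j < m, v (1 - p ^ (j + 1)) = 1)
    (hε : v (1 - a * p ^ m) < 1) (hε0 : 1 - a * p ^ m ≠ 0) :
    v (poisedSum p a m - poisedExpansion p a m) ≤ v (1 - a * p ^ m) ^ 5 := by
  rw [poisedSum, poisedExpansion]
  have hp0 : p ≠ 0 := fun h => by simp [h] at hvp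
  have ha : a ≠ 0 := fun h => by simp [h] at hva
  rcases m with _ | m
  · simp [shifted_zero, qHarm]
  have ua : ∀ k < m + 1, v (1 - a * p ^ k) = 1 := fun k hk =>
    valuation_one_sub_mul_pow hvp hk hpj hε
  have up : ∀ k ≤ m + 1, v (shifted p p k) = 1 := fun k hk =>
    valuation_shifted_eq_one fun j hj => by rw [← pow_succ']; exact hpj j (by omega)
  have h3 : ∀ k < m + 1 + 1, 1 - a * p ^ k ≠ 0 := by
    intro k hk
    rcases Nat.lt_succ_iff_lt_or_eq.1 hk with h | h
    · intro h0; simpa [h0] using ua k h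
    · rwa [h]
  have hvy : v (a * p ^ (m + 1)) = 1 := by simp [hva, hvp]
  have cH : ∀ k ≤ m + 1, v (qHarm p k) ≤ 1 := fun k hk =>
    valuation_qHarm_le_one hvp fun j hj => hpj j (by omega)
  rw [watson_specialized hp0 ha _ hp h3]
  have hB := residual_cong hvp hva hp m hpj hε
  have hP := watson_evaluation hp0 ha (m + 1) (fun j _ => by rw [← pow_succ']; exact hp j) h3
    (fun j hj h => by
      have h1 : v (p * (a * p ^ (m + 1)) * p ^ j - p ^ (j + 1)) < 1 := by
        rw [show p * (a * p ^ (m + 1)) * p ^ j - p ^ (j + 1) =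
          -((1 - a * p ^ (m + 1)) * p ^ (j + 1)) by ring, Valuation.map_neg, map_mul, map_pow, hvp]
        simpa using hε
      rw [sub_eq_zero] at h
      rw [← h, hpj j hj] at h1
      exact lt_irrefl _ h1)
  have hX : ∀ k < m + 1 + 1, v (watsonFactor p a (m + 1) *
      (watsonTerm p a (m + 1) k / shifted p p k ^ 2)) ≤ v (1 - a * p ^ (m + 1)) := by
    intro k hk
    have hW : v (watsonReduced p a m k) ≤ (v (1 - a * p ^ k))⁻¹ := by
      have s1 : v (shifted p (a * p) m) ≤ 1 := valuation_shifted_le_one hvp.le (by simp [hva, hvp]) m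
      have s2 : v (shifted p (p / a) k) ≤ 1 := valuation_shifted_le_one hvp.le (by simp [hva, hvp]) k
      have s3 : v (shifted p (a * p * p ^ (m + 1)) k) ≤ 1 :=
        valuation_shifted_le_one hvp.le (by simp [hva, hvp]) k
      have s4 : v (shifted p (p ^ (m + 1))⁻¹ k) ≤ 1 :=
        valuation_shifted_le_one hvp.le (by simp [hvp]) k
      have s5 : v (1 - a) ≤ 1 := v.map_sub_le (by simp) hva.le
      simp only [watsonReduced, map_mul, map_div₀, map_pow, up _ le_rfl,
        up k (Nat.lt_succ_iff.1 hk), hva, hvp, one_pow, mul_one, div_one]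
      rw [div_eq_mul_inv, ← mul_assoc]
      exact mul_le_of_le_one_left' (mul_le_one' (mul_le_one' (pow_le_one' s5 2) (pow_le_one' s1 2))
        (mul_le_one' (mul_le_one' s2 s3) s4))
    rw [watsonReduced_eq, map_mul, map_pow]
    rcases Nat.lt_succ_iff_lt_or_eq.1 hk with h | h
    · rw [ua k h, inv_one] at hW
      exact mul_le_of_le_of_le_one (pow_le_of_le_one zero_le hε.le two_ne_zero) hW
    · rw [h] at hW ⊢
      refine (mul_le_mul_right hW _).trans_eq ?_
      rw [pow_two, mul_assoc, mul_inv_cancel₀ (by simpa using hε0), mul_one]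
  have hXr : ∀ k, watsonFactor p a (m + 1) * (watsonTerm p a (m + 1) k / shifted p p k ^ 2) =
      (1 - a * p ^ (m + 1)) ^ 2 * watsonReduced p a m k := watsonReduced_eq p a m
  have hη : ∀ k < m + 1 + 1, v (shifted p p k ^ 2 / (shifted p (p * (a * p ^ (m + 1))) k *
      shifted p (p / (a * p ^ (m + 1))) k) - 1 - (1 - a * p ^ (m + 1)) ^ 2 / (a * p ^ (m + 1)) *
      qHarm p k) ≤ v (1 - a * p ^ (m + 1)) ^ 4 := fun k hk =>
    watson_ratio_expansion hvp hvy hε fun j hj => hpj j (by omega : j < m + 1)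
  rw [mul_sum] at hP
  have hP' : ∑ k ∈ range (m + 1 + 1), watsonFactor p a (m + 1) *
      (watsonTerm p a (m + 1) k / shifted p p k ^ 2) * (shifted p p k ^ 2 /
        (shifted p (p * (a * p ^ (m + 1))) k * shifted p (p / (a * p ^ (m + 1))) k)) =
      (1 - a * p ^ (m + 1)) * shifted p (a ^ 2) (m + 1) / (a ^ (m + 1) * shifted p p (m + 1)) := by
    rw [← hP]
    refine sum_congr rfl fun k _ => ?_
    rw [mul_assoc, div_mul_div_cancel₀ (pow_ne_zero 2 (shifted_self_ne_zero hp k))]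
  clear hP
  generalize hX' : (fun k => watsonFactor p a (m + 1) *
      (watsonTerm p a (m + 1) k / shifted p p k ^ 2)) = X at *
  generalize hω' : (fun k => shifted p p k ^ 2 /
        (shifted p (p * (a * p ^ (m + 1))) k * shifted p (p / (a * p ^ (m + 1))) k)) = ω at *
  have eX : ∀ k, watsonFactor p a (m + 1) *
      (watsonTerm p a (m + 1) k / shifted p p k ^ 2) = X k := fun k => congrFun hX' k
  have eω : ∀ k, shifted p p k ^ 2 / (shifted p (p * (a * p ^ (m + 1))) k *
      shifted p (p / (a * p ^ (m + 1))) k) = ω k := fun k => congrFun hω' k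
  simp only [eX, eω] at *
  have hvy0 : a * p ^ (m + 1) ≠ 0 := fun h => by simp [h] at hvy
  generalize a * p ^ (m + 1) = y at *
  generalize (1 - y) * shifted p (a ^ 2) (m + 1) / (a ^ (m + 1) * shifted p p (m + 1)) = P at *
  generalize ∑ k ∈ range (m + 1), residualTerm p a (m + 1) k = R at *
  have hw : v ((1 - y) ^ 2 / y) ≤ v (1 - y) ^ 2 := by simp [hvy]
  have hw1 : v ((1 - y) ^ 2 / y) ≤ 1 := hw.trans (pow_le_one' hε.le 2)
  have key : ∑ k ∈ range (m + 1 + 1), X k -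
      (P * (1 - ((1 - y) ^ 2 + (1 - y) ^ 3) * qHarm p (m + 1)) + (1 - y) ^ 4 * R) =
      ∑ k ∈ range (m + 1 + 1), X k * ((1 - y) ^ 2 / y * qHarm p (m + 1) *
        ((1 - y) ^ 2 / y * qHarm p k + (ω k - 1 - (1 - y) ^ 2 / y * qHarm p k)) -
          (ω k - 1 - (1 - y) ^ 2 / y * qHarm p k)) +
      -((1 - y) ^ 4 / y * qHarm p (m + 1) * P) +
      (1 - y) ^ 4 * (∑ k ∈ range (m + 1), watsonReduced p a m k / y *
        (qHarm p (m + 1) - qHarm p k) - R) := by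
    have e1 : (1 - y) ^ 4 * ∑ k ∈ range (m + 1), watsonReduced p a m k / y *
        (qHarm p (m + 1) - qHarm p k) = ∑ k ∈ range (m + 1 + 1), X k * ((1 - y) ^ 2 / y) *
        (qHarm p (m + 1) - qHarm p k) := by
      rw [sum_range_succ _ (m + 1), sub_self, mul_zero, add_zero, mul_sum]
      exact sum_congr rfl fun k _ => by rw [hXr]; ring
    rw [mul_sub ((1 - y) ^ 4), e1]
    have e2 : (1 - y) ^ 4 / y = (1 - y) ^ 2 / y - (1 - y) ^ 2 - (1 - y) ^ 3 := by
      field_simp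
    rw [e2, ← hP']
    generalize (1 - y) ^ 2 / y = w
    have e3 : ∀ (s : Finset ℕ), ∑ k ∈ s, X k * (w * qHarm p (m + 1) * (w * qHarm p k +
        (ω k - 1 - w * qHarm p k)) - (ω k - 1 - w * qHarm p k)) =
        w * qHarm p (m + 1) * ∑ k ∈ s, X k * ω k - w * qHarm p (m + 1) * ∑ k ∈ s, X k -
        ∑ k ∈ s, X k * ω k + ∑ k ∈ s, X k + w * ∑ k ∈ s, X k * qHarm p k := by
      intro s
      simp only [mul_sum, ← sum_sub_distrib, ← sum_add_distrib]
      exact sum_congr rfl fun k _ => by ring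
    have e4 : ∀ (s : Finset ℕ), ∑ k ∈ s, X k * w * (qHarm p (m + 1) - qHarm p k) =
        w * qHarm p (m + 1) * ∑ k ∈ s, X k - w * ∑ k ∈ s, X k * qHarm p k := by
      intro s
      simp only [mul_sum, ← sum_sub_distrib]
      exact sum_congr rfl fun k _ => by ring
    rw [e3, e4]
    ring
  rw [key]
  have h4 : v (1 - y) ^ 4 ≤ 1 := pow_le_one' hε.le 4
  have hωP : ∀ k < m + 1 + 1, v (ω k) ≤ 1 := by
    intro k hk
    rw [show ω k = (ω k - 1 - (1 - y) ^ 2 / y * qHarm p k) + (1 + (1 - y) ^ 2 / y * qHarm p k) by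
      ring]
    refine v.map_add_le ((hη k hk).trans h4) (v.map_add_le (by simp) ?_)
    rw [map_mul]
    exact mul_le_one' hw1 (cH k (by omega))
  refine v.map_add_le (v.map_add_le (v.map_sum_le fun k hk => ?_) ?_) ?_
  · have hk := mem_range.1 hk
    rw [map_mul, pow_succ' _ 4]
    refine mul_le_mul' (hX k hk) (v.map_sub_le ?_ (hη k hk))
    rw [mul_assoc, map_mul, show v (1 - y) ^ 4 = v (1 - y) ^ 2 * v (1 - y) ^ 2 by
      rw [← pow_add], map_mul]
    refine mul_le_mul' hw (mul_le_of_le_one_of_le (cH _ le_rfl) (v.map_add_le ?_ ?_))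
    · rw [map_mul]; exact mul_le_of_le_of_le_one hw (cH k (by omega))
    · exact (hη k hk).trans (pow_le_pow_right_of_le_one' hε.le (by norm_num))
  · rw [Valuation.map_neg, map_mul, map_mul, map_div₀, hvy, div_one, map_pow, pow_succ _ 4]
    refine mul_le_mul' (mul_le_of_le_one_right' (cH _ le_rfl)) ?_
    rw [← hP']
    refine v.map_sum_le fun k hk => ?_
    rw [map_mul]
    exact mul_le_of_le_of_le_one (hX k (mem_range.1 hk)) (hωP k (mem_range.1 hk))
  · rw [map_mul, map_pow, pow_succ _ 4]
    exact mul_le_mul_right hB _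

end Expansion


section Cyclotomic

open WithZero IsDedekindDomain

/-- The prime ideal of `ℚ[X]` generated by the `m`-th cyclotomic polynomial. -/
noncomputable def cyclotomicPrime {m : ℕ} (hm : 0 < m) : HeightOneSpectrum ℚ[X] where
  asIdeal := Ideal.span {cyclotomic m ℚ}
  isPrime := (Ideal.span_singleton_prime (cyclotomic_ne_zero m ℚ)).2
    (cyclotomic.irreducible_rat hm).prime
  ne_bot := by simpa using cyclotomic_ne_zero m ℚ

/-- The order of vanishing at the `m`-th cyclotomic polynomial, as a valuation. -/
noncomputable def cyclotomicVal {m : ℕ} (hm : 0 < m) : Valuation (RatFunc ℚ) ℤᵐ⁰ :=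
  (cyclotomicPrime hm).valuation (RatFunc ℚ)

variable {m : ℕ} (hm : 0 < m)

lemma cyclotomicVal_algebraMap_le_iff (f : ℚ[X]) (e : ℕ) :
    cyclotomicVal hm (algebraMap ℚ[X] (RatFunc ℚ) f) ≤ exp (-(e : ℤ)) ↔
      cyclotomic m ℚ ^ e ∣ f := by
  rw [cyclotomicVal, HeightOneSpectrum.valuation_of_algebraMap,
    HeightOneSpectrum.intValuation_le_pow_iff_mem, cyclotomicPrime, Ideal.span_singleton_pow,
    Ideal.mem_span_singleton]

lemma cyclotomicVal_algebraMap_le_one (f : ℚ[X]) :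
    cyclotomicVal hm (algebraMap ℚ[X] (RatFunc ℚ) f) ≤ 1 := by
  simpa using (cyclotomicVal_algebraMap_le_iff hm f 0).2 (by simp)

lemma cyclotomic_pow_dvd_num {x : RatFunc ℚ} {e : ℕ}
    (h : cyclotomicVal hm x ≤ exp (-(e : ℤ))) : cyclotomic m ℚ ^ e ∣ x.num := by
  rw [← cyclotomicVal_algebraMap_le_iff hm]
  have hd : algebraMap ℚ[X] (RatFunc ℚ) x.denom ≠ 0 := by simpa using x.denom_ne_zero
  rw [← div_mul_cancel₀ (algebraMap ℚ[X] (RatFunc ℚ) x.num) hd, RatFunc.num_div_denom, map_mul]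
  exact mul_le_of_le_of_le_one h (cyclotomicVal_algebraMap_le_one hm _)

lemma cyclotomic_dvd_X_pow_sub_one_iff {m : ℕ} (hm : 0 < m) {i : ℕ} (hi : 0 < i) :
    cyclotomic m ℚ ∣ X ^ i - 1 ↔ m ∣ i := by
  refine ⟨fun h => ?_, fun h => ?_⟩
  · have hp := (cyclotomic.irreducible_rat hm).prime
    rw [← prod_cyclotomic_eq_X_pow_sub_one hi] at h
    obtain ⟨j, hj, hmj⟩ := hp.exists_mem_finset_dvd h
    by_cases e : m = j
    · exact e ▸ Nat.dvd_of_mem_divisors hj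
    · exact absurd ((cyclotomic.isCoprime_rat e).isUnit_of_dvd hmj) hp.not_isUnit
  · rw [← prod_cyclotomic_eq_X_pow_sub_one hi]
    exact dvd_prod_of_mem _ (Nat.mem_divisors.2 ⟨h, hi.ne'⟩)

lemma one_sub_q_pow (i : ℕ) :
    1 - q ^ i = -algebraMap ℚ[X] (RatFunc ℚ) (X ^ i - 1) := by
  simp [q]

lemma q_ne_zero : q ≠ 0 := RatFunc.X_ne_zero

lemma exp_le_of_lt {x : ℤᵐ⁰} {k : ℤ} (h : exp (k - 1) < x) : exp k ≤ x := by
  rcases eq_or_ne x 0 with rfl | hx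
  · simp at h
  · rw [← exp_log hx, exp_lt_exp] at h
    rw [← exp_log hx, exp_le_exp]
    omega

lemma cyclotomicVal_q : cyclotomicVal hm q = 1 := by
  have h : cyclotomicVal hm (1 - q ^ m) < 1 := by
    rw [one_sub_q_pow, Valuation.map_neg]
    refine lt_of_le_of_lt ((cyclotomicVal_algebraMap_le_iff hm _ 1).2 ?_) (by
      rw [← exp_zero, exp_lt_exp]; norm_num)
    rw [pow_one, cyclotomic_dvd_X_pow_sub_one_iff hm hm]
  have h2 : cyclotomicVal hm (q ^ m) = 1 := by
    rw [← sub_sub_cancel 1 (q ^ m)]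
    exact Valuation.map_one_sub_of_lt _ h
  rw [map_pow] at h2
  exact (pow_eq_one_iff_of_nonneg zero_le hm.ne').1 h2

lemma cyclotomicVal_q_zpow (i : ℤ) : cyclotomicVal hm (q ^ i) = 1 := by
  rw [map_zpow₀, cyclotomicVal_q, one_zpow]

lemma cyclotomicVal_one_sub_zpow_neg (i : ℤ) :
    cyclotomicVal hm (1 - q ^ (-i)) = cyclotomicVal hm (1 - q ^ i) := by
  have : 1 - q ^ (-i) = -(q ^ (-i) * (1 - q ^ i)) := by
    rw [mul_sub, ← zpow_add₀ q_ne_zero]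
    simp
  rw [this, Valuation.map_neg, map_mul, cyclotomicVal_q_zpow, one_mul]

lemma cyclotomicVal_one_sub_of_not_dvd {i : ℤ} (h : ¬ (m : ℤ) ∣ i) :
    cyclotomicVal hm (1 - q ^ i) = 1 := by
  have key : ∀ j : ℕ, ¬ m ∣ j → cyclotomicVal hm (1 - q ^ (j : ℤ)) = 1 := by
    intro j hj
    have hj0 : 0 < j := Nat.pos_of_ne_zero fun h0 => hj (h0 ▸ dvd_zero m)
    rw [zpow_natCast, one_sub_q_pow, Valuation.map_neg]
    refine le_antisymm (cyclotomicVal_algebraMap_le_one hm _) ?_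
    rw [← exp_zero]
    refine exp_le_of_lt ?_
    by_contra! hc
    exact hj ((cyclotomic_dvd_X_pow_sub_one_iff hm hj0).1
      (by simpa using (cyclotomicVal_algebraMap_le_iff hm _ 1).1 (by simpa using hc)))
  obtain ⟨j, rfl | rfl⟩ := i.eq_nat_or_neg
  · exact key j (by simpa [Int.natCast_dvd_natCast] using h)
  · rw [cyclotomicVal_one_sub_zpow_neg]
    exact key j (by simpa [Int.natCast_dvd_natCast] using h)

lemma cyclotomicVal_one_sub_of_dvd {i : ℤ} (hi : i ≠ 0) (h : (m : ℤ) ∣ i) :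
    cyclotomicVal hm (1 - q ^ i) = exp (-1) := by
  have key : ∀ j : ℕ, 0 < j → m ∣ j → cyclotomicVal hm (1 - q ^ (j : ℤ)) = exp (-1) := by
    intro j hj hmj
    rw [zpow_natCast, one_sub_q_pow, Valuation.map_neg]
    refine le_antisymm ((cyclotomicVal_algebraMap_le_iff hm _ 1).2 ?_) (exp_le_of_lt ?_)
    · rwa [pow_one, cyclotomic_dvd_X_pow_sub_one_iff hm hj]
    · by_contra! hc
      have h2 := (cyclotomicVal_algebraMap_le_iff hm _ 2).1 hc
      have hsq : Squarefree (X ^ j - 1 : ℚ[X]) :=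
        (X_pow_sub_one_separable_iff.2 (by simpa using hj.ne')).squarefree
      exact (cyclotomic.irreducible_rat hm).not_isUnit (hsq _ (by rwa [← pow_two]))
  obtain ⟨j, rfl | rfl⟩ := i.eq_nat_or_neg
  · exact key j (by omega) (by simpa [Int.natCast_dvd_natCast] using h)
  · rw [cyclotomicVal_one_sub_zpow_neg]
    exact key j (by omega) (by simpa [Int.natCast_dvd_natCast] using h)

lemma one_sub_q_zpow_ne_zero {i : ℤ} (hi : i ≠ 0) : 1 - q ^ i ≠ 0 := by
  intro h
  have := cyclotomicVal_one_sub_of_dvd one_pos hi (by simp)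
  rw [h, map_zero] at this
  exact exp_ne_zero this.symm

theorem modCong_of_cyclotomicVal {n : ℕ} (hn : 0 < n) (hn1 : n ≠ 1) {A B : RatFunc ℚ}
    (h5 : cyclotomicVal hn (A - B) ≤ exp (-5))
    (h1 : ∀ m (hm : 0 < m), m ∣ n → m ≠ 1 → m ≠ n → cyclotomicVal hm (A - B) ≤ exp (-1)) :
    modCong A B (qintPoly n * cyclotomic n ℚ ^ 4) := by
  have hP : qintPoly n * cyclotomic n ℚ ^ 4 =
      cyclotomic n ℚ ^ 5 * ∏ i ∈ (n.divisors.erase 1).erase n, cyclotomic i ℚ := by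
    rw [qintPoly, ← prod_cyclotomic_eq_geom_sum hn,
      ← mul_prod_erase (n.divisors.erase 1) _ (a := n) (by simp [hn1, hn.ne'])]
    ring
  have hdvd : qintPoly n * cyclotomic n ℚ ^ 4 ∣ (A - B).num := by
    rw [hP]
    refine IsCoprime.mul_dvd (.pow_left (.prod_right fun i hi => cyclotomic.isCoprime_rat ?_))
      (cyclotomic_pow_dvd_num hn h5) (prod_dvd_of_coprime ?_ fun i hi => ?_)
    · exact (ne_of_mem_erase hi).symm
    · exact fun i _ j _ hij => cyclotomic.isCoprime_rat hij
    · simp only [mem_erase, Nat.mem_divisors] at hi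
      have hi0 := Nat.pos_of_dvd_of_pos hi.2.2.1 hn
      simpa using cyclotomic_pow_dvd_num hi0 (e := 1) (h1 i hi0 hi.2.2.1 hi.2.1 hi.1)
  obtain ⟨c, hc⟩ := hdvd
  refine ⟨c, (A - B).denom, ?_, ?_⟩
  · exact ((A - B).isCoprime_num_denom.of_isCoprime_of_dvd_left ⟨c, hc⟩).symm
  · rw [← hc, RatFunc.num_div_denom]

end Cyclotomic


section Counting

open WithZero

variable {m : ℕ} (hm : 0 < m)

lemma qPoch_succ (s d : ℤ) (k : ℕ) :
    qPoch s d (k + 1) = qPoch s d k * (1 - q ^ (s + d * (k : ℤ))) :=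
  prod_range_succ _ _

lemma qPoch_eq_shifted (s d : ℤ) (k : ℕ) : qPoch s d k = shifted (q ^ d) (q ^ s) k := by
  simp only [qPoch, shifted]
  refine prod_congr rfl fun j _ => ?_
  rw [zpow_add₀ q_ne_zero, zpow_mul, zpow_natCast]

lemma cyclotomicVal_qPoch_le (s d : ℤ) (k : ℕ) :
    cyclotomicVal hm (qPoch s d k) ≤
      exp (-(Nat.count (fun j : ℕ => (m : ℤ) ∣ s + d * j) k : ℤ)) := by
  induction k with
  | zero => simp [qPoch]
  | succ k ih =>
    rw [qPoch_succ, Nat.count_succ, map_mul, Nat.cast_add, neg_add, exp_add]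
    refine mul_le_mul' ih ?_
    split_ifs with h
    · by_cases h0 : s + d * k = 0
      · simp [h0]
      · rw [cyclotomicVal_one_sub_of_dvd hm h0 h]; simp
    · rw [cyclotomicVal_one_sub_of_not_dvd hm h]; simp

lemma cyclotomicVal_qPoch {s d : ℤ} {k : ℕ} (h0 : ∀ j < k, s + d * (j : ℤ) ≠ 0) :
    cyclotomicVal hm (qPoch s d k) =
      exp (-(Nat.count (fun j : ℕ => (m : ℤ) ∣ s + d * j) k : ℤ)) := by
  induction k with
  | zero => simp [qPoch]
  | succ k ih =>
    rw [qPoch_succ, Nat.count_succ, map_mul, Nat.cast_add, neg_add, exp_add,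
      ih fun j hj => h0 j (by omega)]
    congr 1
    split_ifs with h
    · rw [cyclotomicVal_one_sub_of_dvd hm (h0 k (by omega)) h]; simp
    · rw [cyclotomicVal_one_sub_of_not_dvd hm h]; simp

lemma exists_dvd_add_mul_iff {m : ℕ} (hm : 0 < m) {d : ℤ} (hd : IsCoprime (m : ℤ) d) (s : ℤ) :
    ∃ j₀ : ℕ, ∀ j : ℕ, (m : ℤ) ∣ s + d * j ↔ j ≡ j₀ [MOD m] := by
  have : NeZero m := ⟨hm.ne'⟩
  obtain ⟨u, w, h⟩ := hd
  have hw : (w : ZMod m) * d = 1 := by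
    have := congrArg (Int.cast : ℤ → ZMod m) h
    simpa using this
  refine ⟨(-(w * s : ZMod m)).val, fun j => ?_⟩
  rw [← ZMod.intCast_zmod_eq_zero_iff_dvd, ← ZMod.natCast_eq_natCast_iff]
  simp only [ZMod.natCast_val, ZMod.cast_id', id]
  push_cast
  constructor
  · intro h1
    linear_combination (w : ZMod m) * h1 - (j : ZMod m) * hw
  · intro h1
    linear_combination (d : ZMod m) * h1 - (s : ZMod m) * hw

lemma cyclotomicVal_qPoch_le_exp {d : ℤ} (hd : IsCoprime (m : ℤ) d) (s : ℤ) (k : ℕ) :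
    cyclotomicVal hm (qPoch s d k) ≤ exp (-((k / m : ℕ) : ℤ)) := by
  refine (cyclotomicVal_qPoch_le hm s d k).trans ?_
  obtain ⟨j₀, hj⟩ := exists_dvd_add_mul_iff hm hd s
  simp only [hj]
  rw [exp_le_exp, Nat.count_modEq_card _ hm]
  push_cast
  omega

lemma exp_le_cyclotomicVal_qPoch_succ {d : ℤ} (hd : IsCoprime (m : ℤ) d) {s : ℤ} {k : ℕ}
    (h0 : ∀ j < k + 1, s + d * (j : ℤ) ≠ 0) :
    exp (-((k / m : ℕ) : ℤ) - 1) ≤ cyclotomicVal hm (qPoch s d (k + 1)) := by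
  rw [cyclotomicVal_qPoch hm h0]
  obtain ⟨j₀, hj⟩ := exists_dvd_add_mul_iff hm hd s
  simp only [hj]
  rw [exp_le_exp, Nat.count_modEq_card _ hm]
  have h1 : (k + 1) / m + (if j₀ % m < (k + 1) % m then 1 else 0) ≤ k / m + 1 := by
    by_cases h : m ∣ k + 1
    · rw [Nat.mod_eq_zero_of_dvd h, if_neg (by omega), Nat.succ_div_of_dvd h]
    · rw [Nat.succ_div_of_not_dvd h]; split_ifs <;> omega
  omega

lemma cyclotomicVal_qPoch_self {d : ℤ} (hd0 : d ≠ 0) (hd : IsCoprime (m : ℤ) d) (k : ℕ) :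
    cyclotomicVal hm (qPoch d d k) = exp (-((k / m : ℕ) : ℤ)) := by
  have e : ∀ j : ℕ, d + d * (j : ℤ) = ((j + 1 : ℕ) : ℤ) * d := fun j => by push_cast; ring
  rw [cyclotomicVal_qPoch hm fun j _ => by rw [e]; exact mul_ne_zero (by omega) hd0]
  have hj : ∀ j : ℕ, (m : ℤ) ∣ d + d * j ↔ j ≡ m - 1 [MOD m] := by
    intro j
    rw [e, show (m : ℤ) ∣ ((j + 1 : ℕ) : ℤ) * d ↔ (m : ℤ) ∣ ((j + 1 : ℕ) : ℤ) from
      ⟨hd.dvd_of_dvd_mul_right, fun h => h.mul_right d⟩, Int.natCast_dvd_natCast, ← Nat.modEq_zero_iff_dvd]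
    have : 0 ≡ m - 1 + 1 [MOD m] := by
      rw [Nat.sub_add_cancel hm]; exact (Nat.modEq_zero_iff_dvd.2 dvd_rfl).symm
    exact ⟨fun h => Nat.ModEq.add_right_cancel' 1 (h.trans this),
      fun h => (h.add_right 1).trans this.symm⟩
  simp only [hj]
  rw [Nat.count_modEq_card _ hm, if_neg, add_zero]
  rw [Nat.mod_eq_of_lt (by omega)]
  have := Nat.mod_lt k hm
  omega

section ExpBounds

variable {K : Type*} [Field K] {v : Valuation K ℤᵐ⁰} {x y : K} {e f : ℤ}

lemma map_mul_le_exp (hx : v x ≤ exp e) (hy : v y ≤ exp f) : v (x * y) ≤ exp (e + f) := by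
  rw [map_mul, exp_add]
  exact mul_le_mul' hx hy

lemma exp_le_map_mul (hx : exp e ≤ v x) (hy : exp f ≤ v y) : exp (e + f) ≤ v (x * y) := by
  rw [map_mul, exp_add]
  exact mul_le_mul' hx hy

lemma map_div_le_exp (hx : v x ≤ exp e) (hy : exp f ≤ v y) : v (x / y) ≤ exp (e - f) := by
  rw [map_div₀, exp_sub]
  exact div_le_div₀ zero_le hx exp_pos hy

lemma map_pow_le_exp (hx : v x ≤ exp e) (k : ℕ) : v (x ^ k) ≤ exp (k * e) := by
  rw [map_pow, ← nsmul_eq_mul, exp_nsmul]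
  exact pow_le_pow_left' hx k

lemma exp_le_map_pow (hx : exp e ≤ v x) (k : ℕ) : exp (k * e) ≤ v (x ^ k) := by
  rw [map_pow, ← nsmul_eq_mul, exp_nsmul]
  exact pow_le_pow_left' hx k

end ExpBounds

variable {d r : ℤ} {M : ℕ}

lemma one_sub_q_zpow_pow_ne_zero (hd0 : d ≠ 0) (j : ℕ) : 1 - (q ^ d) ^ (j + 1) ≠ 0 := by
  rw [← zpow_natCast, ← zpow_mul]
  exact one_sub_q_zpow_ne_zero (mul_ne_zero hd0 (by omega))

lemma one_sub_q_zpow_mul (r d : ℤ) (k : ℕ) : 1 - q ^ r * (q ^ d) ^ k = 1 - q ^ (r + d * k) := by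
  rw [zpow_add₀ q_ne_zero, zpow_mul, zpow_natCast]

lemma exp_le_cyclotomicVal_one_sub {i : ℤ} (hi : i ≠ 0) :
    exp (-1) ≤ cyclotomicVal hm (1 - q ^ i) := by
  by_cases h : (m : ℤ) ∣ i
  · rw [cyclotomicVal_one_sub_of_dvd hm hi h]
  · rw [cyclotomicVal_one_sub_of_not_dvd hm h, ← exp_zero, exp_le_exp]
    omega

lemma cyclotomicVal_poisedSum_le (hd0 : d ≠ 0) (hd : IsCoprime (m : ℤ) d)
    (hr : ∀ k ≤ M, r + d * (k : ℤ) ≠ 0) (hN : (m : ℤ) ∣ r + d * M) :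
    cyclotomicVal hm (poisedSum (q ^ d) (q ^ r) M) ≤ exp (-1) := by
  rw [poisedSum, watson_specialized (zpow_ne_zero _ q_ne_zero) (zpow_ne_zero _ q_ne_zero) M
    (one_sub_q_zpow_pow_ne_zero hd0) fun k hk => by
      rw [one_sub_q_zpow_mul]; exact one_sub_q_zpow_ne_zero (hr k (by omega))]
  refine Valuation.map_sum_le _ fun k hk => ?_
  have hk : k ≤ M := by simpa [Nat.lt_succ_iff] using hk
  have e : watsonFactor (q ^ d) (q ^ r) M * (watsonTerm (q ^ d) (q ^ r) M k /
      shifted (q ^ d) (q ^ d) k ^ 2) =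
      (qPoch r d M * (1 - q ^ (r + d * M))) ^ 2 * (qPoch (d - r) d k *
        qPoch (r + d + d * M) d k * qPoch (-(d * M)) d k * q ^ (d * k)) /
      (qPoch d d M ^ 2 * q ^ (r * M) * (1 - q ^ (r + d * k)) * qPoch d d k ^ 3) := by
    have e1 : qPoch r d M * (1 - q ^ (r + d * M)) =
        (1 - q ^ r) * shifted (q ^ d) (q ^ r * q ^ d) M := by
      rw [← qPoch_succ, qPoch_eq_shifted, shifted_succ']
    rw [e1, qPoch_eq_shifted (d - r), qPoch_eq_shifted (r + d + d * M), qPoch_eq_shifted (-(d * M)),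
      qPoch_eq_shifted d d, qPoch_eq_shifted d d, ← one_sub_q_zpow_mul, zpow_sub₀ q_ne_zero,
      zpow_add₀ q_ne_zero, zpow_add₀ q_ne_zero, zpow_neg, zpow_mul, zpow_mul, zpow_mul,
      zpow_natCast, zpow_natCast, zpow_natCast, watsonFactor, watsonTerm]
    simp only [div_eq_mul_inv, mul_inv]
    ring
  rw [e]
  have h0 := cyclotomicVal_q_zpow hm
  have h1 := cyclotomicVal_one_sub_of_dvd hm (hr M le_rfl) hN
  refine (map_div_le_exp
    (map_mul_le_exp (map_pow_le_exp (map_mul_le_exp (cyclotomicVal_qPoch_le_exp hm hd r M)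
      h1.le) 2) (map_mul_le_exp (map_mul_le_exp (map_mul_le_exp
      (cyclotomicVal_qPoch_le_exp hm hd _ k) (cyclotomicVal_qPoch_le_exp hm hd _ k))
      (cyclotomicVal_qPoch_le_exp hm hd _ k)) ((h0 _).trans exp_zero.symm).le))
    (exp_le_map_mul (exp_le_map_mul (exp_le_map_mul
      (exp_le_map_pow (cyclotomicVal_qPoch_self hm hd0 hd M).ge 2) (exp_zero.trans (h0 _).symm).le)
      (exp_le_cyclotomicVal_one_sub hm (hr k hk)))
      (exp_le_map_pow (cyclotomicVal_qPoch_self hm hd0 hd k).ge 3))).trans ?_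
  rw [exp_le_exp]
  push_cast
  linarith

lemma cyclotomicVal_poisedExpansion_le (hd0 : d ≠ 0) (hd : IsCoprime (m : ℤ) d)
    (hr : ∀ k ≤ M, r + d * (k : ℤ) ≠ 0) (hN : (m : ℤ) ∣ r + d * M) :
    cyclotomicVal hm (poisedExpansion (q ^ d) (q ^ r) M) ≤ exp (-1) := by
  have h0 := cyclotomicVal_q_zpow hm
  have h1 := cyclotomicVal_one_sub_of_dvd hm (hr M le_rfl) hN
  rw [← one_sub_q_zpow_mul] at h1
  have hH : cyclotomicVal hm (qHarm (q ^ d) M) ≤ exp 2 := by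
    refine Valuation.map_sum_le _ fun j _ => ?_
    rw [← zpow_natCast, ← zpow_mul]
    exact (map_div_le_exp ((h0 _).trans exp_zero.symm).le (exp_le_map_pow
      (exp_le_cyclotomicVal_one_sub hm (mul_ne_zero hd0 (by omega))) 2)).trans
      (exp_le_exp.2 (by norm_num))
  have haa : q ^ (2 * r) = (q ^ r) ^ 2 := by rw [mul_comm, zpow_mul, ← zpow_natCast]; rfl
  rw [poisedExpansion]
  refine Valuation.map_add_le _ ?_ ?_
  · have hH' : cyclotomicVal hm (1 - ((1 - q ^ r * (q ^ d) ^ M) ^ 2 +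
        (1 - q ^ r * (q ^ d) ^ M) ^ 3) * qHarm (q ^ d) M) ≤ exp 0 := by
      refine Valuation.map_sub_le _ (by simp) ((map_mul_le_exp (Valuation.map_add_le _
        (map_pow_le_exp h1.le 2) ((map_pow_le_exp h1.le 3).trans (exp_le_exp.2 ?_))) hH).trans
        (exp_le_exp.2 ?_)) <;> norm_num
    rw [← haa, ← qPoch_eq_shifted, ← qPoch_eq_shifted]
    refine (map_mul_le_exp (map_div_le_exp (map_mul_le_exp h1.le
      (cyclotomicVal_qPoch_le_exp hm hd _ M)) (exp_le_map_mul
        (exp_le_map_pow (exp_zero.trans (h0 _).symm).le M)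
        (cyclotomicVal_qPoch_self hm hd0 hd M).ge)) hH').trans (exp_le_exp.2 ?_)
    linarith
  · refine (map_mul_le_exp (map_pow_le_exp h1.le 4) (f := 3)
      (Valuation.map_sum_le _ fun k hk => ?_)).trans (exp_le_exp.2 (by norm_num))
    have hk : k < M := mem_range.1 hk
    have e : residualTerm (q ^ d) (q ^ r) M k = (q ^ d) ^ k * (q ^ (r + d * M)) ^ (2 * M - k) *
        (qPoch d d k * qPoch (2 * r) d k) /
        (((q ^ d) ^ M) ^ 2 * ((1 - q ^ (r + d * k)) * qPoch r d (k + 1) ^ 2)) := by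
      rw [residualTerm, qPoch_succ, qPoch_eq_shifted, qPoch_eq_shifted, qPoch_eq_shifted, haa,
        zpow_add₀ q_ne_zero, zpow_mul, zpow_natCast, ← one_sub_q_zpow_mul]
      ring
    rw [e]
    refine (map_div_le_exp (map_mul_le_exp (e := 0) (by simp [h0])
      (map_mul_le_exp (cyclotomicVal_qPoch_le_exp hm hd _ k)
        (cyclotomicVal_qPoch_le_exp hm hd _ k)))
      (exp_le_map_mul (e := 0) (by simp [h0]) (exp_le_map_mul
        (exp_le_cyclotomicVal_one_sub hm (hr k hk.le)) (exp_le_map_pow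
        (exp_le_cyclotomicVal_qPoch_succ hm hd fun j hj => hr j (by omega)) 2)))).trans
      (exp_le_exp.2 ?_)
    push_cast
    linarith

end Counting


lemma sum_Icc_one_eq_sum_range {R : Type*} [AddCommMonoid R] (f : ℕ → R) (m : ℕ) :
    ∑ k ∈ Icc 1 m, f k = ∑ i ∈ range m, f (i + 1) := by
  rw [range_eq_Ico, sum_Ico_add' f 0 m 1]
  rfl

lemma one_sub_q_ne_zero : 1 - q ≠ 0 := by
  simpa using one_sub_q_zpow_ne_zero one_ne_zero

lemma sum_qint_eq_poisedSum (d r : ℤ) (M : ℕ) :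
    ∑ k ∈ range (M + 1), qint (2 * d * k + r) * qPoch r d k ^ 4 / qPoch d d k ^ 4 *
      q ^ ((d - 2 * r) * k) = poisedSum (q ^ d) (q ^ r) M / (1 - q) := by
  rw [poisedSum, sum_div]
  refine sum_congr rfl fun k _ => ?_
  have e1 : q ^ (2 * d * k + r) = q ^ r * ((q ^ d) ^ k) ^ 2 := by
    rw [zpow_add₀ q_ne_zero, ← pow_mul, ← zpow_natCast, ← zpow_mul, mul_comm]
    congr 2
    push_cast
    ring
  have e2 : q ^ ((d - 2 * r) * k) = (q ^ d / (q ^ r) ^ 2) ^ k := by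
    rw [zpow_mul, zpow_natCast, zpow_sub₀ q_ne_zero, mul_comm 2 r, zpow_mul]
    rfl
  rw [qint, e1, e2, qPoch_eq_shifted, qPoch_eq_shifted]
  ring

lemma qint_expansion_eq_poisedExpansion {n d : ℕ} (hd : 0 < d) {r : ℤ} {M : ℕ}
    (h : ((d : ℤ) - 1) * n = r + d * M) :
    q ^ ((r * ((n : ℤ) + r - d * n)) / d) * (qPoch (2 * r) d M / qPoch d d M) *
        (qint (((d : ℤ) - 1) * n) -
          ((qint (((d : ℤ) - 1) * n)) ^ 3 + (qint (((d : ℤ) - 1) * n)) ^ 4 * (1 - q)) *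
          ∑ k ∈ Finset.Icc 1 M, q ^ (k * d) / (qint (k * d)) ^ 2) +
       (qint (((d : ℤ) - 1) * n)) ^ 4 *
        ∑ k ∈ Finset.Icc 1 M,
          q ^ ((((k : ℤ) * d - d - 2 * d * n + 2 * n + 2 * r) * ((d : ℤ) - d * n + n)) / d) *
            (qPoch d d (k - 1) * qPoch (2 * r) d (k - 1)) /
            ((qint ((d : ℤ) * k - d + r)) ^ 3 * (qPoch r d (k - 1)) ^ 2) =
      poisedExpansion (q ^ (d : ℤ)) (q ^ r) M / (1 - q) := by
  have hd0 : (d : ℤ) ≠ 0 := by omega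
  have h1 := one_sub_q_ne_zero
  have haa : q ^ (2 * r) = (q ^ r) ^ 2 := by rw [mul_comm, zpow_mul]; rfl
  have eN : q ^ (((d : ℤ) - 1) * n) = q ^ r * (q ^ (d : ℤ)) ^ M := by
    rw [h, zpow_add₀ q_ne_zero, zpow_mul, zpow_natCast]
  have e1 : q ^ ((r * ((n : ℤ) + r - d * n)) / d) = ((q ^ r) ^ M)⁻¹ := by
    rw [show r * ((n : ℤ) + r - d * n) = -(r * M) * d by linear_combination (-r) * h,
      Int.mul_ediv_cancel _ hd0, zpow_neg, zpow_mul, zpow_natCast]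
  have eH : ∑ k ∈ Finset.Icc 1 M, q ^ (k * d) / (qint (k * d)) ^ 2 =
      (1 - q) ^ 2 * qHarm (q ^ (d : ℤ)) M := by
    rw [sum_Icc_one_eq_sum_range, qHarm, mul_sum]
    refine sum_congr rfl fun j _ => ?_
    have e : q ^ (((j + 1 : ℕ) : ℤ) * d) = (q ^ (d : ℤ)) ^ (j + 1) := by
      rw [mul_comm, zpow_mul, zpow_natCast]
    have e' : q ^ ((j + 1) * d) = (q ^ (d : ℤ)) ^ (j + 1) := by
      rw [← e, ← Nat.cast_mul, zpow_natCast]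
    rw [qint, e, e', div_pow, div_div_eq_mul_div]
    ring
  have eR : ∑ k ∈ Finset.Icc 1 M,
      q ^ ((((k : ℤ) * d - d - 2 * d * n + 2 * n + 2 * r) * ((d : ℤ) - d * n + n)) / d) *
        (qPoch d d (k - 1) * qPoch (2 * r) d (k - 1)) /
        ((qint ((d : ℤ) * k - d + r)) ^ 3 * (qPoch r d (k - 1)) ^ 2) =
      (1 - q) ^ 3 * ∑ k ∈ range M, residualTerm (q ^ (d : ℤ)) (q ^ r) M k := by
    rw [sum_Icc_one_eq_sum_range, mul_sum]
    refine sum_congr rfl fun j hj => ?_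
    have hj := mem_range.1 hj
    have e : q ^ (((((j + 1 : ℕ) : ℤ) * d - d - 2 * d * n + 2 * n + 2 * r) *
        ((d : ℤ) - d * n + n)) / d) =
        (q ^ (d : ℤ)) ^ j * (q ^ r * (q ^ (d : ℤ)) ^ M) ^ (2 * M - j) / ((q ^ (d : ℤ)) ^ M) ^ 2 := by
      rw [show (((j + 1 : ℕ) : ℤ) * d - d - 2 * d * n + 2 * n + 2 * r) * ((d : ℤ) - d * n + n) =
        ((d : ℤ) * j + (r + d * M) * (2 * M - j : ℕ) - d * M * 2) * d by
          rw [Nat.cast_sub (by omega)]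
          push_cast
          rw [show (d : ℤ) - d * n + n = d - (r + d * M) by linear_combination -h]
          linear_combination (-2) * (d - (r + d * M) : ℤ) * h,
        Int.mul_ediv_cancel _ hd0, zpow_sub₀ q_ne_zero, zpow_add₀ q_ne_zero, zpow_mul, zpow_mul,
        zpow_mul, zpow_mul, zpow_add₀ q_ne_zero, zpow_mul]
      rfl
    rw [qint, show (d : ℤ) * (j + 1 : ℕ) - d + r = r + d * j by push_cast; ring,
      ← one_sub_q_zpow_mul, e, Nat.add_sub_cancel, qPoch_eq_shifted, qPoch_eq_shifted,
      qPoch_eq_shifted, haa, residualTerm, div_pow, div_mul_eq_mul_div]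
    simp only [div_eq_mul_inv, mul_inv, inv_inv]
    ring
  rw [eH, eR, e1, qint, eN, poisedExpansion, qPoch_eq_shifted, qPoch_eq_shifted, haa]
  generalize 1 - q ^ r * (q ^ (d : ℤ)) ^ M = ε
  generalize qHarm (q ^ (d : ℤ)) M = H
  generalize ∑ k ∈ range M, residualTerm (q ^ (d : ℤ)) (q ^ r) M k = R
  generalize 1 - q = t at *
  have : ε / t - ((ε / t) ^ 3 + (ε / t) ^ 4 * t) * (t ^ 2 * H) =
      ε * (1 - (ε ^ 2 + ε ^ 3) * H) / t := by
    field_simp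
  rw [this]
  have : (ε / t) ^ 4 * (t ^ 3 * R) = ε ^ 4 * R / t := by field_simp
  rw [this, add_div]
  simp only [div_eq_mul_inv, mul_inv]
  ring

/-- Theorem 1.6 of the paper, case `M = ((d-1)n-r)/d`: modulo `[n]Φ_n(q)^4`. -/
theorem stmt16 (n d : ℕ) (hn : 0 < n) (hd : 2 ≤ d) (hnd : Nat.gcd n d = 1) (r : ℤ)
    (hr1 : (d : ℤ) - n ≤ r) (hr2 : r ≤ (d : ℤ) * n - n)
    (hmod : (n : ℤ) ≡ -r [ZMOD (d : ℤ)]) :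
    modCong
      (∑ k ∈ Finset.range (((((d : ℤ) - 1) * n - r) / d).toNat + 1),
        qint (2 * d * k + r) * (qPoch r d k) ^ 4 / (qPoch d d k) ^ 4 *
          q ^ (((d : ℤ) - 2 * r) * k))
      (q ^ ((r * ((n : ℤ) + r - d * n)) / d) *
        (qPoch (2 * r) d ((((d : ℤ) - 1) * n - r) / d).toNat /
          qPoch d d ((((d : ℤ) - 1) * n - r) / d).toNat) *
        (qint (((d : ℤ) - 1) * n) -
          ((qint (((d : ℤ) - 1) * n)) ^ 3 + (qint (((d : ℤ) - 1) * n)) ^ 4 * (1 - q)) *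
          ∑ k ∈ Finset.Icc 1 ((((d : ℤ) - 1) * n - r) / d).toNat,
            q ^ (k * d) / (qint (k * d)) ^ 2) +
       (qint (((d : ℤ) - 1) * n)) ^ 4 *
        ∑ k ∈ Finset.Icc 1 ((((d : ℤ) - 1) * n - r) / d).toNat,
          q ^ ((((k : ℤ) * d - d - 2 * d * n + 2 * n + 2 * r) * ((d : ℤ) - d * n + n)) / d) *
            (qPoch d d (k - 1) * qPoch (2 * r) d (k - 1)) /
            ((qint ((d : ℤ) * k - d + r)) ^ 3 * (qPoch r d (k - 1)) ^ 2))
      (qintPoly n * (Polynomial.cyclotomic n ℚ) ^ 4) := by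
  have hd0 : (d : ℤ) ≠ 0 := by omega
  have hdpos : (0 : ℤ) < d := by omega
  obtain ⟨z, hz⟩ : (d : ℤ) ∣ ((d : ℤ) - 1) * n - r := by
    have h1 := hmod.dvd
    rw [show ((d : ℤ) - 1) * n - r = d * n + (-r - n) by ring]
    exact dvd_add (dvd_mul_right _ _) h1
  have hz0 : 0 ≤ z := by
    refine nonneg_of_mul_nonneg_right (a := (d : ℤ)) ?_ hdpos
    rw [← hz]
    linarith
  obtain ⟨M, rfl⟩ := Int.eq_ofNat_of_zero_le hz0
  have h : ((d : ℤ) - 1) * n = r + d * M := by linarith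
  have hMn : M < n := by
    have : (d : ℤ) * (M + 1) ≤ d * n := by linarith
    have := le_of_mul_le_mul_left this hdpos
    omega
  rw [hz, Int.mul_ediv_cancel_left _ hd0, Int.toNat_natCast, sum_qint_eq_poisedSum,
    qint_expansion_eq_poisedExpansion (by omega) h]
  have hr : ∀ k ≤ M, r + d * (k : ℤ) ≠ 0 := by
    intro k _ hk
    have h1 : (d : ℤ) ∣ n := by
      have h2 : (n : ℤ) = d * (n - M + k) := by linear_combination -h - hk
      exact ⟨_, h2⟩
    have h2 := Nat.eq_one_of_dvd_coprimes hnd (Int.natCast_dvd_natCast.1 h1) dvd_rfl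
    omega
  rcases eq_or_ne n 1 with rfl | hn1
  · obtain rfl : M = 0 := by omega
    refine ⟨0, 1, isCoprime_one_left, ?_⟩
    simp [poisedSum, poisedExpansion, shifted_zero, qHarm]
  have hcop : ∀ m : ℕ, m ∣ n → IsCoprime (m : ℤ) d := fun m hmn =>
    Nat.isCoprime_iff_coprime.2 (Nat.Coprime.coprime_dvd_left hmn hnd)
  have hone : ∀ m (hm : 0 < m), m ≠ 1 → cyclotomicVal hm (1 - q) = 1 := by
    intro m hm hm1
    simpa using cyclotomicVal_one_sub_of_not_dvd hm (i := 1) fun hdvd =>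
      hm1 (by exact_mod_cast Int.eq_one_of_dvd_one (by omega) hdvd)
  have hN : (n : ℤ) ∣ r + d * M := h ▸ dvd_mul_left _ _
  refine modCong_of_cyclotomicVal hn hn1 ?_ fun m hm hmn hm1 hmn' => ?_
  · rw [← sub_div, map_div₀, hone n hn hn1, div_one]
    have hε := cyclotomicVal_one_sub_of_dvd hn (hr M le_rfl) hN
    rw [← one_sub_q_zpow_mul] at hε
    refine (poised_expansion (cyclotomicVal_q_zpow hn _) (cyclotomicVal_q_zpow hn _)
      (one_sub_q_zpow_pow_ne_zero hd0) M (fun j hj => ?_) ?_ ?_).trans ?_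
    · rw [← zpow_natCast, ← zpow_mul]
      refine cyclotomicVal_one_sub_of_not_dvd hn fun hdvd => ?_
      have := Int.natCast_dvd_natCast.1 ((hcop n dvd_rfl).dvd_of_dvd_mul_left hdvd)
      have := Nat.le_of_dvd (by omega) this
      omega
    · rw [hε, ← WithZero.exp_zero, WithZero.exp_lt_exp]
      norm_num
    · rw [one_sub_q_zpow_mul]
      exact one_sub_q_zpow_ne_zero (hr M le_rfl)
    · rw [hε, ← WithZero.exp_nsmul]
      norm_num
  · rw [← sub_div, map_div₀, hone m hm hm1, div_one]
    have hmN := (Int.natCast_dvd_natCast.2 hmn).trans hN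
    exact Valuation.map_sub_le _ (cyclotomicVal_poisedSum_le hm hd0 (hcop m hmn) hr hmN)
      (cyclotomicVal_poisedExpansion_le hm hd0 (hcop m hmn) hr hmN)
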